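/- arXiv:1804.02517 — 2 statements merged into one kernel-verified Lean document; each statement's English description precedes it below -/
import Mathlib

section
/- Let X be a Peano continuum having a free arc, which is neither an arc nor a circle. If J is a maximal free open interval of Type I in X and f : X → X is a continuous open map, then there is a maximal free open interval K of Type I in X such that f(J) ⊆ K, and the restriction f : J → f(J) ⊆ K is injective. -/
open Set Metric Topology

/-- The whole space `X` is an arc, i.e. homeomorphic to `[0,1]`. -/
def SpaceIsArc (X : Type*) [TopologicalSpace X] : Prop :=
  Nonempty (X ≃ₜ Set.Icc (0:ℝ) 1)

/-- The whole space `X` is a circle, i.e. homeomorphic to the unit circle in `ℂ`. -/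
def SpaceIsCircle (X : Type*) [TopologicalSpace X] : Prop :=
  Nonempty (X ≃ₜ Metric.sphere (0:ℂ) 1)

/-- A subset `A` is an arc: with the subspace topology it is homeomorphic to `[0,1]`. -/
def IsArc {X : Type*} [TopologicalSpace X] (A : Set X) : Prop :=
  Nonempty (A ≃ₜ Set.Icc (0:ℝ) 1)

/-- A subset `A` is a circle: with the subspace topology it is homeomorphic to `S¹`. -/
def IsCircleSet {X : Type*} [TopologicalSpace X] (A : Set X) : Prop :=
  Nonempty (A ≃ₜ Metric.sphere (0:ℂ) 1)

/-- `A` is an arc with endpoints `a` and `b`: it is the image of a continuous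
injective parametrization of `[0,1]` with `γ 0 = a` and `γ 1 = b`. -/
def IsArcEnds {X : Type*} [TopologicalSpace X] (A : Set X) (a b : X) : Prop :=
  ∃ γ : ℝ → X, ContinuousOn γ (Set.Icc 0 1) ∧ Set.InjOn γ (Set.Icc 0 1) ∧
    γ '' Set.Icc 0 1 = A ∧ γ 0 = a ∧ γ 1 = b

/-- A free open interval: an open subset homeomorphic to `(0,1)`. -/
def IsFreeOpenInterval {X : Type*} [TopologicalSpace X] (J : Set X) : Prop :=
  IsOpen J ∧ Nonempty (J ≃ₜ Set.Ioo (0:ℝ) 1)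

/-- A free arc: the closure of a free open interval, homeomorphic to `[0,1]`. -/
def IsFreeArc {X : Type*} [TopologicalSpace X] (A : Set X) : Prop :=
  ∃ J : Set X, IsFreeOpenInterval J ∧ A = closure J ∧ IsArc A

/-- A maximal free open interval: no free open interval properly contains it. -/
def IsMaxFreeOpenInterval {X : Type*} [TopologicalSpace X] (J : Set X) : Prop :=
  IsFreeOpenInterval J ∧ ∀ K : Set X, IsFreeOpenInterval K → J ⊆ K → J = K

/-- `x` is an endpoint of the space `X`: every open set containing `x` contains an
open neighborhood of `x` whose boundary is a single point. -/
def IsEndpointOf (X : Type*) [TopologicalSpace X] (x : X) : Prop :=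
  ∀ U : Set X, IsOpen U → x ∈ U → ∃ V : Set X, IsOpen V ∧ x ∈ V ∧ V ⊆ U ∧
    ∃ y : X, frontier V = {y}

/-- A maximal free open interval of Type I: its closure is an arc `J ∪ {a,b}` with
`a, b ∉ J` and at least one of `a, b` an endpoint of `X`. -/
def IsTypeI {X : Type*} [TopologicalSpace X] (J : Set X) : Prop :=
  IsMaxFreeOpenInterval J ∧ ∃ a b : X, a ≠ b ∧ a ∉ J ∧ b ∉ J ∧
    closure J = J ∪ {a, b} ∧ IsArcEnds (closure J) a b ∧
    (IsEndpointOf X a ∨ IsEndpointOf X b)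

/-- The model simple triod in the complex plane: three unit segments from the
origin in directions `π/3`, `π`, `5π/3`. -/
noncomputable def triodModel : Set ℂ :=
  ⋃ θ ∈ ({Real.pi / 3, Real.pi, 5 * Real.pi / 3} : Set ℝ),
    (fun r : ℝ => (r : ℂ) * Complex.exp (θ * Complex.I)) '' Set.Icc (0:ℝ) 1

/-- `A` is a simple triod. -/
def IsSimpleTriod {X : Type*} [TopologicalSpace X] (A : Set X) : Prop :=
  Nonempty (A ≃ₜ triodModel)

/-- `U` contains no simple triod. -/
def ContainsNoTriod {X : Type*} [TopologicalSpace X] (U : Set X) : Prop :=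
  ∀ A : Set X, A ⊆ U → ¬ IsSimpleTriod A

/-- The distance between two subsets of a metric space:
`d(S,T) = inf { dist s t | s ∈ S, t ∈ T }`. -/
noncomputable def setDist {X : Type*} [MetricSpace X] (S T : Set X) : ℝ :=
  sInf (Set.image2 dist S T)

/-- `h` parametrizes an arc on `[0, r]` such that the half-open arc `h '' [0, r)` is open. -/
structure IsOpenRay {X : Type*} [TopologicalSpace X] (h : ℝ → X) (r : ℝ) : Prop where
  pos : 0 < r
  cont : ContinuousOn h (Icc 0 r)
  inj : InjOn h (Icc 0 r)
  isOpen : IsOpen (h '' Ico 0 r)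

theorem isOpen_image_Ico_of_le {X : Type*} [TopologicalSpace X] [T2Space X] {h : ℝ → X}
    {r t : ℝ} (hc : ContinuousOn h (Icc 0 r)) (hi : InjOn h (Icc 0 r))
    (ho : IsOpen (h '' Ico 0 r)) (htr : t ≤ r) : IsOpen (h '' Ico 0 t) := by
  rcases le_or_gt t 0 with h0 | h0
  · rw [Ico_eq_empty (by linarith)]; simp
  have hK : IsClosed (h '' Icc t r) :=
    (isCompact_Icc.image_of_continuousOn (hc.mono (Icc_subset_Icc_left h0.le))).isClosed
  have : h '' Ico 0 t = h '' Ico 0 r \ h '' Icc t r := by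
    ext x
    constructor
    · rintro ⟨s, hs, rfl⟩
      refine ⟨⟨s, ⟨hs.1, hs.2.trans_le htr⟩, rfl⟩, ?_⟩
      rintro ⟨u, hu, e⟩
      have := hi ⟨h0.le.trans hu.1, hu.2⟩ ⟨hs.1, hs.2.le.trans htr⟩ e
      linarith [hu.1, hs.2]
    · rintro ⟨⟨s, hs, rfl⟩, hn⟩
      refine ⟨s, ⟨hs.1, ?_⟩, rfl⟩
      by_contra hst
      exact hn ⟨s, ⟨not_lt.1 hst, hs.2.le⟩, rfl⟩
  rw [this]
  exact ho.sdiff hK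

theorem isOpen_image_Ioo_of_le {X : Type*} [TopologicalSpace X] [T2Space X] {h : ℝ → X}
    {s t : ℝ} (hs : 0 ≤ s) (hc : ContinuousOn h (Ico 0 t)) (hi : InjOn h (Ico 0 t))
    (ho : IsOpen (h '' Ico 0 t)) : IsOpen (h '' Ioo s t) := by
  rcases le_or_gt t s with h0 | h0
  · rw [Ioo_eq_empty (by linarith)]; simp
  have hK : IsClosed (h '' Icc 0 s) :=
    (isCompact_Icc.image_of_continuousOn
      (hc.mono fun x hx => ⟨hx.1, hx.2.trans_lt h0⟩)).isClosed
  have : h '' Ioo s t = h '' Ico 0 t \ h '' Icc 0 s := by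
    ext x
    constructor
    · rintro ⟨u, hu, rfl⟩
      refine ⟨⟨u, ⟨hs.trans hu.1.le, hu.2⟩, rfl⟩, ?_⟩
      rintro ⟨v, hv, e⟩
      have := hi ⟨hv.1, hv.2.trans_lt h0⟩ ⟨hs.trans hu.1.le, hu.2⟩ e
      linarith [hv.2, hu.1]
    · rintro ⟨⟨u, hu, rfl⟩, hn⟩
      refine ⟨u, ⟨?_, hu.2⟩, rfl⟩
      by_contra hst
      exact hn ⟨u, ⟨hu.1, not_lt.1 hst⟩, rfl⟩
  rw [this]
  exact ho.sdiff hK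

theorem IsOpenRay.mono {X : Type*} [TopologicalSpace X] [T2Space X] {h : ℝ → X} {r t : ℝ}
    (H : IsOpenRay h r) (h0 : 0 < t) (htr : t ≤ r) : IsOpenRay h t :=
  ⟨h0, H.cont.mono (Icc_subset_Icc_right htr), H.inj.mono (Icc_subset_Icc_right htr),
    isOpen_image_Ico_of_le H.cont H.inj H.isOpen htr⟩

theorem IsOpenRay.isPreconnected {X : Type*} [TopologicalSpace X] {h : ℝ → X} {r : ℝ}
    (H : IsOpenRay h r) : IsPreconnected (h '' Ico 0 r) :=
  isPreconnected_Ico.image _ (H.cont.mono Ico_subset_Icc_self)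

theorem IsOpenRay.notMem_image {X : Type*} [TopologicalSpace X] {h : ℝ → X} {r : ℝ}
    (H : IsOpenRay h r) : h r ∉ h '' Ico 0 r := by
  rintro ⟨s, hs, e⟩
  have := H.inj (Ico_subset_Icc_self hs) ⟨H.pos.le, le_rfl⟩ e
  exact hs.2.ne this

theorem IsOpenRay.closure_image {X : Type*} [TopologicalSpace X] [T2Space X] {h : ℝ → X}
    {r : ℝ} (H : IsOpenRay h r) : closure (h '' Ico 0 r) = h '' Icc 0 r := by
  apply subset_antisymm
  · exact closure_minimal (image_mono Ico_subset_Icc_self)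
      (isCompact_Icc.image_of_continuousOn H.cont).isClosed
  · have := ContinuousOn.image_closure (f := h) (s := Ico 0 r)
      (by rw [closure_Ico H.pos.ne]; exact H.cont)
    rwa [closure_Ico H.pos.ne] at this

theorem IsOpenRay.closure_image_Ioo {X : Type*} [TopologicalSpace X] [T2Space X] {h : ℝ → X}
    {r : ℝ} (H : IsOpenRay h r) : closure (h '' Ioo 0 r) = h '' Icc 0 r := by
  apply subset_antisymm
  · exact closure_minimal (image_mono Ioo_subset_Icc_self)
      (isCompact_Icc.image_of_continuousOn H.cont).isClosed
  · have := ContinuousOn.image_closure (f := h) (s := Ioo 0 r)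
      (by rw [closure_Ioo H.pos.ne]; exact H.cont)
    rwa [closure_Ioo H.pos.ne] at this

theorem IsOpenRay.eq_of_mem_closure {X : Type*} [TopologicalSpace X] [T2Space X] {h : ℝ → X}
    {r : ℝ} (H : IsOpenRay h r) {x : X} (hx : x ∈ closure (h '' Ico 0 r))
    (hn : x ∉ h '' Ico 0 r) : x = h r := by
  rw [H.closure_image] at hx
  obtain ⟨t, ht, rfl⟩ := hx
  rcases ht.2.eq_or_lt with rfl | h1
  · rfl
  · exact absurd ⟨t, ⟨ht.1, h1⟩, rfl⟩ hn

theorem IsPreconnected.subset_of_inter_closed_subset {X : Type*} [TopologicalSpace X]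
    {S Q C : Set X} (hS : IsPreconnected S) (hQ : IsOpen Q) (hC : IsClosed C)
    (hQC : Q ⊆ C) (hCS : S ∩ C ⊆ Q) (hne : (S ∩ Q).Nonempty) : S ⊆ Q := by
  refine hS.subset_left_of_subset_union hQ hC.isOpen_compl
    (disjoint_left.2 fun x hx hx' => hx' (hQC hx)) (fun x hx => ?_) hne
  by_cases h : x ∈ C
  · exact Or.inl (hCS ⟨hx, h⟩)
  · exact Or.inr h

/-- Two open rays with the same origin are comparable. -/
theorem IsOpenRay.subset_or_initial {X : Type*} [TopologicalSpace X] [T2Space X]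
    {h k : ℝ → X} {r q : ℝ} (H : IsOpenRay h r) (K : IsOpenRay k q) (h0 : h 0 = k 0) :
    k '' Ico 0 q ⊆ h '' Ico 0 r ∨
      ∃ t, 0 < t ∧ t < q ∧ k '' Ico 0 t = h '' Ico 0 r ∧ k t = h r := by
  by_cases hsub : k '' Ico 0 q ⊆ h '' Ico 0 r
  · exact Or.inl hsub
  right
  obtain ⟨x, ⟨u, hu, rfl⟩, hux⟩ := not_subset.1 hsub
  set B : Set ℝ := Icc 0 u ∩ k ⁻¹' (h '' Ico 0 r)ᶜ with hB
  have hBc : IsClosed B :=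
    (K.cont.mono (Icc_subset_Icc_right hu.2.le)).preimage_isClosed_of_isClosed isClosed_Icc
      H.isOpen.isClosed_compl
  have hBne : B.Nonempty := ⟨u, ⟨hu.1, le_rfl⟩, hux⟩
  have hBb : BddBelow B := ⟨0, fun t ht => ht.1.1⟩
  set t := sInf B with ht
  have htB : t ∈ B := hBc.csInf_mem hBne hBb
  have hlt : ∀ s, 0 ≤ s → s < t → k s ∈ h '' Ico 0 r := by
    intro s hs0 hst
    by_contra hn
    have : s ∈ B := ⟨⟨hs0, hst.le.trans htB.1.2⟩, hn⟩
    exact absurd (csInf_le hBb this) (not_le.2 hst)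
  have ht0 : 0 < t := by
    rcases htB.1.1.eq_or_lt with e | e
    · exfalso
      apply htB.2
      rw [← e, ← h0]
      exact ⟨0, ⟨le_rfl, H.pos⟩, rfl⟩
    · exact e
  have htq : t < q := htB.1.2.trans_lt hu.2
  have Kt := K.mono ht0 htq.le
  have hsub : k '' Ico 0 t ⊆ h '' Ico 0 r := by
    rintro _ ⟨s, hs, rfl⟩
    exact hlt s hs.1 hs.2
  refine ⟨t, ht0, htq, subset_antisymm hsub ?_, ?_⟩
  · refine H.isPreconnected.subset_of_inter_closed_subset Kt.isOpen isClosed_closure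
      subset_closure ?_ ?_
    · rintro x ⟨hx1, hx2⟩
      by_contra hn
      have := Kt.eq_of_mem_closure hx2 hn
      exact htB.2 (this ▸ hx1)
    · exact ⟨k 0, h0 ▸ ⟨0, ⟨le_rfl, H.pos⟩, rfl⟩, ⟨0, ⟨le_rfl, ht0⟩, rfl⟩⟩
  · refine H.eq_of_mem_closure (closure_mono hsub ?_) htB.2
    rw [Kt.closure_image]
    exact ⟨t, ⟨ht0.le, le_rfl⟩, rfl⟩

theorem exists_arc_reparam {X : Type*} [TopologicalSpace X] {k : ℝ → X} {c d r q : ℝ}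
    (hcd : c < d) (hrq : r < q) (hc : ContinuousOn k (Icc c d)) (hi : InjOn k (Icc c d)) :
    ∃ k' : ℝ → X, ContinuousOn k' (Icc r q) ∧ InjOn k' (Icc r q) ∧ k' r = k c ∧ k' q = k d ∧
      k' '' Icc r q = k '' Icc c d ∧ k' '' Ico r q = k '' Ico c d := by
  have hm : 0 < (d - c) / (q - r) := div_pos (by linarith) (by linarith)
  set m := (d - c) / (q - r) with hmd
  have hmm : m * (q - r) = d - c := by rw [hmd]; field_simp [(by linarith : q - r ≠ 0)]
  have e0 : m * r + (c - m * r) = c := by ring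
  have e1 : m * q + (c - m * r) = d := by linarith
  have hI : (fun t : ℝ => m * t + (c - m * r)) '' Icc r q = Icc c d := by
    rw [image_affine_Icc' hm, e0, e1]
  have hI' : (fun t : ℝ => m * t + (c - m * r)) '' Ico r q = Ico c d := by
    rw [image_affine_Ico hm, e0, e1]
  have hmaps : MapsTo (fun t : ℝ => m * t + (c - m * r)) (Icc r q) (Icc c d) := by
    rw [← hI]; exact mapsTo_image _ _
  refine ⟨fun t => k (m * t + (c - m * r)), ?_, ?_, by simp [e0], by simp [e1], ?_, ?_⟩
  · exact hc.comp (by fun_prop) hmaps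
  · intro x hx y hy e
    have := hi (hmaps hx) (hmaps hy) e
    have : m * x = m * y := by simpa using this
    exact mul_left_cancel₀ hm.ne' this
  · rw [← hI, image_image]
  · rw [← hI', image_image]

theorem IsOpenRay.rescale {X : Type*} [TopologicalSpace X] {h : ℝ → X} {r q : ℝ}
    (H : IsOpenRay h r) (hq : 0 < q) :
    ∃ k, IsOpenRay k q ∧ k 0 = h 0 ∧ k q = h r ∧ k '' Ico 0 q = h '' Ico 0 r := by
  obtain ⟨k, kc, ki, k0, k1, -, k2⟩ := exists_arc_reparam H.pos hq H.cont H.inj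
  exact ⟨k, ⟨hq, kc, ki, k2 ▸ H.isOpen⟩, k0, k1, k2⟩

/-- Prolonging an open ray by an arc. -/
theorem IsOpenRay.glue {X : Type*} [TopologicalSpace X] {h k : ℝ → X} {r q : ℝ}
    (H : IsOpenRay h r) (hrq : r < q) (kc : ContinuousOn k (Icc r q)) (ki : InjOn k (Icc r q))
    (hk : k r = h r) (hd : ∀ t ∈ Icc r q, k t ∉ h '' Ico 0 r)
    (ho : IsOpen (h '' Ico 0 r ∪ k '' Ico r q)) :
    ∃ g, IsOpenRay g q ∧ EqOn g h (Icc 0 r) ∧ g '' Ico 0 q = h '' Ico 0 r ∪ k '' Ico r q := by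
  classical
  set g : ℝ → X := fun t => if t ≤ r then h t else k t with hg
  have gh : EqOn g h (Icc 0 r) := fun t ht => by simp [hg, ht.2]
  have gk : EqOn g k (Icc r q) := fun t ht => by
    rcases ht.1.eq_or_lt with e | e
    · subst e; simp [hg, hk]
    · simp [hg, not_le.2 e]
  have hun : Icc 0 r ∪ Icc r q = Icc 0 q := Icc_union_Icc_eq_Icc H.pos.le hrq.le
  have him : g '' Ico 0 q = h '' Ico 0 r ∪ k '' Ico r q := by
    rw [← Ico_union_Ico_eq_Ico H.pos.le hrq.le, image_union,
      (gh.mono Ico_subset_Icc_self).image_eq, (gk.mono Ico_subset_Icc_self).image_eq]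
  refine ⟨g, ⟨H.pos.trans hrq, ?_, ?_, him ▸ ho⟩, gh, him⟩
  · rw [← hun]
    exact (H.cont.congr gh).union_of_isClosed (kc.congr gk) isClosed_Icc isClosed_Icc
  · have key : ∀ s t, s ∈ Icc 0 q → t ∈ Icc 0 q → s < r → r ≤ t → g s ≠ g t := by
      intro s t hs ht hsr hrt e
      rw [gh ⟨hs.1, hsr.le⟩, gk ⟨hrt, ht.2⟩] at e
      exact hd t ⟨hrt, ht.2⟩ ⟨s, ⟨hs.1, hsr⟩, e⟩
    intro s hs t ht e
    rcases lt_or_ge s r with h1 | h1 <;> rcases lt_or_ge t r with h2 | h2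
    · rw [gh ⟨hs.1, h1.le⟩, gh ⟨ht.1, h2.le⟩] at e
      exact H.inj ⟨hs.1, h1.le⟩ ⟨ht.1, h2.le⟩ e
    · exact absurd e (key s t hs ht h1 h2)
    · exact absurd e.symm (key t s ht hs h2 h1)
    · rw [gk ⟨h1, hs.2⟩, gk ⟨h2, ht.2⟩] at e
      exact ki ⟨h1, hs.2⟩ ⟨h2, ht.2⟩ e

/-- An open ray can be prolonged, keeping its parametrization, to cover any larger one. -/
theorem IsOpenRay.exists_extend {X : Type*} [TopologicalSpace X] [T2Space X] {h k : ℝ → X}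
    {r q p : ℝ} (H : IsOpenRay h r) (K : IsOpenRay k q) (h0 : h 0 = k 0)
    (hn : ¬ k '' Ico 0 q ⊆ h '' Ico 0 r) (hrp : r < p) :
    ∃ g, IsOpenRay g p ∧ EqOn g h (Icc 0 r) ∧ g '' Ico 0 p = k '' Ico 0 q := by
  obtain ⟨t, ht0, htq, him, htr⟩ := (H.subset_or_initial K h0).resolve_left hn
  have hsub : Icc t q ⊆ Icc 0 q := Icc_subset_Icc_left ht0.le
  obtain ⟨k', kc, ki, k0, -, k2, k3⟩ :=
    exists_arc_reparam htq hrp (K.cont.mono hsub) (K.inj.mono hsub)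
  have hun : h '' Ico 0 r ∪ k' '' Ico r p = k '' Ico 0 q := by
    rw [k3, ← him, ← image_union, Ico_union_Ico_eq_Ico ht0.le htq.le]
  rw [← hun]
  refine H.glue hrp kc ki (k0.trans htr) ?_ (hun ▸ K.isOpen)
  intro s hs
  have : k' s ∈ k '' Icc t q := k2 ▸ mem_image_of_mem _ hs
  obtain ⟨u, hu, e⟩ := this
  rw [← e, ← him]
  rintro ⟨v, hv, e'⟩
  have := K.inj ⟨hv.1, hv.2.le.trans htq.le⟩ (hsub hu) e'
  linarith [hv.2, hu.1]

/-- In a locally connected compact space the half-open parametrization of an increasing union of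
open rays converges. -/
theorem exists_tendsto_of_isOpen_image_Ico {X : Type*} [TopologicalSpace X] [T2Space X]
    [CompactSpace X] [LocallyConnectedSpace X] {h : ℝ → X} (hc : ContinuousOn h (Ico 0 1))
    (hi : InjOn h (Ico 0 1)) (ho : ∀ t < 1, IsOpen (h '' Ico 0 t)) :
    ∃ b, Filter.Tendsto h (𝓝[<] 1) (𝓝 b) ∧ b ∉ h '' Ico 0 1 := by
  obtain ⟨b, hb⟩ : ∃ b, MapClusterPt b (𝓝[<] (1 : ℝ)) h :=
    exists_clusterPt_of_compactSpace _
  have hfreq : ∀ V, IsOpen V → b ∈ V → ∀ s < 1, ∃ t, s < t ∧ t < 1 ∧ h t ∈ V := by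
    intro V hV hbV s hs
    have h1 := (mapClusterPt_iff_frequently.1 hb) V (hV.mem_nhds hbV)
    have h2 : ∀ᶠ t in 𝓝[<] (1 : ℝ), t ∈ Ioo s 1 := Ioo_mem_nhdsLT hs
    obtain ⟨t, ht, ht'⟩ := (h1.and_eventually h2).exists
    exact ⟨t, ht'.1, ht'.2, ht⟩
  have hbn : b ∉ h '' Ico 0 1 := by
    rintro ⟨s, hs, rfl⟩
    obtain ⟨u, hsu, hu1⟩ := exists_between hs.2
    obtain ⟨t, ht1, ht2, v, hv, e⟩ := hfreq _ (ho u hu1) ⟨s, ⟨hs.1, hsu⟩, rfl⟩ u hu1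
    have := hi ⟨hv.1, hv.2.trans hu1⟩ ⟨by linarith [hs.1], ht2⟩ e
    linarith [hv.2]
  refine ⟨b, ?_, hbn⟩
  by_contra hnt
  obtain ⟨W, hW, hWn⟩ := Filter.not_tendsto_iff_exists_frequently_notMem.1 hnt
  obtain ⟨V, hVW, hVo, hbV, hVc⟩ :=
    locallyConnectedSpace_iff_subsets_isOpen_isConnected.1 ‹_› b W hW
  have hout : ∀ s < 1, ∃ t, s < t ∧ t < 1 ∧ h t ∉ V := by
    intro s hs
    have h2 : ∀ᶠ t in 𝓝[<] (1 : ℝ), t ∈ Ioo s 1 := Ioo_mem_nhdsLT hs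
    obtain ⟨t, ht, ht'⟩ := (hWn.and_eventually h2).exists
    exact ⟨t, ht'.1, ht'.2, fun hh => ht (hVW hh)⟩
  obtain ⟨s₀, h00, h01, hs₀⟩ := hout 0 one_pos
  obtain ⟨s₁, h10, h11, hs₁⟩ := hfreq V hVo hbV s₀ h01
  obtain ⟨s₂, h20, h21, hs₂⟩ := hout s₁ h11
  have hsub : Icc s₀ s₂ ⊆ Ico 0 1 := fun x hx => ⟨h00.le.trans hx.1, hx.2.trans_lt h21⟩
  have hsub2 : Ico 0 s₂ ⊆ Ico 0 1 := Ico_subset_Ico_right h21.le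
  have hVQ : V ⊆ h '' Ioo s₀ s₂ := by
    refine hVc.isPreconnected.subset_of_inter_closed_subset
      (isOpen_image_Ioo_of_le h00.le (hc.mono hsub2) (hi.mono hsub2) (ho _ h21))
      (isCompact_Icc.image_of_continuousOn (hc.mono hsub)).isClosed
      (image_mono Ioo_subset_Icc_self) ?_ ⟨h s₁, hs₁, s₁, ⟨h10, h20⟩, rfl⟩
    rintro _ ⟨hx, t, ht, rfl⟩
    refine ⟨t, ⟨ht.1.lt_of_ne ?_, ht.2.lt_of_ne ?_⟩, rfl⟩
    · rintro rfl; exact hs₀ hx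
    · rintro rfl; exact hs₂ hx
  obtain ⟨t, ht, e⟩ := hVQ hbV
  exact hbn ⟨t, hsub (Ioo_subset_Icc_self ht), e⟩

/-- Among the open rays issuing from a given point there is a largest one. -/
theorem exists_greatest_isOpenRay {X : Type*} [TopologicalSpace X] [T2Space X]
    [SecondCountableTopology X] [CompactSpace X] [LocallyConnectedSpace X] {g : ℝ → X}
    (G : IsOpenRay g 1) :
    ∃ h, IsOpenRay h 1 ∧ h 0 = g 0 ∧
      ∀ k, IsOpenRay k 1 → k 0 = g 0 → k '' Ico 0 1 ⊆ h '' Ico 0 1 := by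
  classical
  by_contra! hno
  set F : Set (Set X) := {S | ∃ k, IsOpenRay k 1 ∧ k 0 = g 0 ∧ S = k '' Ico 0 1} with hF
  obtain ⟨C, hCc, hCF, hCU⟩ := TopologicalSpace.isOpen_sUnion_countable F
    (by rintro _ ⟨k, K, -, rfl⟩; exact K.isOpen)
  have hCne : C.Nonempty := by
    by_contra hne
    rw [not_nonempty_iff_eq_empty] at hne
    rw [hne, sUnion_empty] at hCU
    have : g 0 ∈ ⋃₀ F := ⟨_, ⟨g, G, rfl, rfl⟩, 0, ⟨le_rfl, one_pos⟩, rfl⟩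
    rw [← hCU] at this
    exact this
  obtain ⟨T, hT⟩ := hCc.exists_eq_range hCne
  set ρ : ℕ → ℝ := fun n => 1 - 1 / ((n : ℝ) + 2) with hρ
  have ρpos : ∀ n, 0 < ρ n := fun n => by
    have : (1 : ℝ) / ((n : ℝ) + 2) < 1 := by
      rw [div_lt_one (by positivity)]; linarith [(Nat.cast_nonneg n : (0 : ℝ) ≤ n)]
    simp only [hρ]; linarith
  have ρlt : ∀ n, ρ n < 1 := fun n => by
    have : (0 : ℝ) < 1 / ((n : ℝ) + 2) := by positivity
    simp only [hρ]; linarith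
  have ρsucc : ∀ n, ρ n < ρ (n + 1) := fun n => by
    simp only [hρ]
    have : (1 : ℝ) / (((n + 1 : ℕ) : ℝ) + 2) < 1 / ((n : ℝ) + 2) :=
      one_div_lt_one_div_of_lt (by positivity) (by push_cast; linarith)
    linarith
  have ρmono : StrictMono ρ := strictMono_nat_of_lt_succ ρsucc
  have ρlim : ∀ t < 1, ∃ n, t < ρ n := fun t ht => by
    obtain ⟨n, hn⟩ := exists_nat_one_div_lt (show (0 : ℝ) < 1 - t by linarith)
    refine ⟨n, ?_⟩
    have : (1 : ℝ) / ((n : ℝ) + 2) < 1 / ((n : ℝ) + 1) :=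
      one_div_lt_one_div_of_lt (by positivity) (by linarith)
    simp only [hρ]; linarith
  have step : ∀ (n : ℕ) (h : ℝ → X), IsOpenRay h (ρ n) ∧ h 0 = g 0 →
      ∃ h', (IsOpenRay h' (ρ (n + 1)) ∧ h' 0 = g 0) ∧ EqOn h' h (Icc 0 (ρ n)) ∧
        T n ⊆ h' '' Ico 0 (ρ (n + 1)) := by
    rintro n h ⟨H, h0⟩
    obtain ⟨h₁, H₁, h₁0, -, him⟩ := H.rescale one_pos
    obtain ⟨k, K, k0, hk⟩ := hno h₁ H₁ (h₁0.trans h0)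
    rw [him] at hk
    have hTF : T n ∈ F := hCF (hT ▸ mem_range_self n)
    obtain ⟨l, M, l0, hl⟩ := hTF
    have key : ∀ m, IsOpenRay m 1 → m 0 = g 0 → ¬ m '' Ico 0 1 ⊆ h '' Ico 0 (ρ n) →
        T n ⊆ m '' Ico 0 1 → ∃ h', (IsOpenRay h' (ρ (n + 1)) ∧ h' 0 = g 0) ∧
        EqOn h' h (Icc 0 (ρ n)) ∧ T n ⊆ h' '' Ico 0 (ρ (n + 1)) := by
      intro m M m0 hm hTm
      obtain ⟨h', H', he, hi⟩ := H.exists_extend M (h0.trans m0.symm) hm (ρsucc n)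
      exact ⟨h', ⟨H', (he ⟨le_rfl, (ρpos n).le⟩).trans h0⟩, he, hi ▸ hTm⟩
    rcases K.subset_or_initial M (k0.trans l0.symm) with hs | ⟨t, ht0, ht1, hs, -⟩
    · exact key k K k0 hk (hl ▸ hs)
    · refine key l M l0 (fun hh => hk (Subset.trans ?_ hh)) hl.le
      rw [← hs]
      exact image_mono (Ico_subset_Ico_right ht1.le)
  obtain ⟨g₀, G₀, g₀0, -, -⟩ := G.rescale (ρpos 0)
  choose! nxt hn1 hn2 hn3 using step
  let seq : ℕ → ℝ → X := fun n => Nat.rec g₀ (fun n h => nxt n h) n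
  have hseq : ∀ n, IsOpenRay (seq n) (ρ n) ∧ seq n 0 = g 0 := by
    intro n
    induction n with
    | zero => exact ⟨G₀, g₀0⟩
    | succ n ih => exact hn1 n _ ih
  have hstep : ∀ n, EqOn (seq (n + 1)) (seq n) (Icc 0 (ρ n)) := fun n => hn2 n _ (hseq n)
  have hTs : ∀ n, T n ⊆ seq (n + 1) '' Ico 0 (ρ (n + 1)) := fun n => hn3 n _ (hseq n)
  have heq : ∀ n m, n ≤ m → EqOn (seq m) (seq n) (Icc 0 (ρ n)) := by
    intro n m hnm
    induction m, hnm using Nat.le_induction with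
    | base => exact fun _ _ => rfl
    | succ m hnm ih =>
      intro t ht
      rw [hstep m ⟨ht.1, ht.2.trans (ρmono.monotone hnm)⟩, ih ht]
  choose! N hN using ρlim
  set h : ℝ → X := fun t => seq (N t) t with hh
  have hhn : ∀ n, EqOn h (seq n) (Ico 0 (ρ n)) := by
    intro n t ht
    have h1 := hN t (ht.2.trans (ρlt n))
    rcases le_total (N t) n with hle | hle
    · exact (heq _ _ hle ⟨ht.1, h1.le⟩).symm
    · exact heq _ _ hle ⟨ht.1, ht.2.le⟩
  have hcont : ContinuousOn h (Ico 0 1) := by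
    intro t ht
    have h1 := hN t ht.2
    have h2 : ContinuousOn h (Ico 0 (ρ (N t))) :=
      ((hseq (N t)).1.cont.mono Ico_subset_Icc_self).congr (hhn _)
    refine (h2 t ⟨ht.1, h1⟩).mono_of_mem_nhdsWithin ?_
    rw [mem_nhdsWithin]
    exact ⟨Iio (ρ (N t)), isOpen_Iio, h1, fun x hx => ⟨hx.2.1, hx.1⟩⟩
  have hinj : InjOn h (Ico 0 1) := by
    have : ∀ s t, s ∈ Ico (0 : ℝ) 1 → t ∈ Ico (0 : ℝ) 1 → s ≤ t → h s = h t → s = t := by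
      intro s t hs ht hst e
      have h1 := hN t ht.2
      rw [hhn (N t) ⟨hs.1, hst.trans_lt h1⟩, hhn (N t) ⟨ht.1, h1⟩] at e
      exact (hseq (N t)).1.inj ⟨hs.1, hst.trans h1.le⟩ ⟨ht.1, h1.le⟩ e
    intro s hs t ht e
    rcases le_total s t with hst | hst
    · exact this s t hs ht hst e
    · exact (this t s ht hs hst e.symm).symm
  have hopen : ∀ t < 1, IsOpen (h '' Ico 0 t) := by
    intro t ht
    have h1 := hN t ht
    rw [((hhn (N t)).mono (Ico_subset_Ico_right h1.le)).image_eq]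
    have H := (hseq (N t)).1
    exact isOpen_image_Ico_of_le H.cont H.inj H.isOpen h1.le
  obtain ⟨b, hb, hbn⟩ := exists_tendsto_of_isOpen_image_Ico hcont hinj hopen
  set h' : ℝ → X := Function.update h 1 b with hh'
  have hh'e : EqOn h' h (Ico 0 1) := fun t ht => Function.update_of_ne ht.2.ne _ _
  have hh'1 : h' 1 = b := Function.update_self _ _ _
  have him : h' '' Ico 0 1 = h '' Ico 0 1 := hh'e.image_eq
  have H' : IsOpenRay h' 1 := by
    refine ⟨one_pos, ?_, ?_, ?_⟩
    · rw [hh', continuousOn_update_iff]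
      have : Icc (0 : ℝ) 1 \ {1} = Ico 0 1 := Icc_sdiff_right
      rw [this]
      exact ⟨hcont, fun _ => hb.mono_left (nhdsWithin_mono _ fun x hx => hx.2)⟩
    · have : ∀ s t, s ∈ Icc (0 : ℝ) 1 → t ∈ Icc (0 : ℝ) 1 → s < t → h' s ≠ h' t := by
        intro s t hs ht hst e
        have hs' : s ∈ Ico (0 : ℝ) 1 := ⟨hs.1, hst.trans_le ht.2⟩
        rw [hh'e hs'] at e
        rcases ht.2.eq_or_lt with rfl | h1
        · rw [hh'1] at e
          exact hbn ⟨s, hs', e⟩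
        · rw [hh'e ⟨ht.1, h1⟩] at e
          exact hst.ne (hinj hs' ⟨ht.1, h1⟩ e)
      intro s hs t ht e
      rcases lt_trichotomy s t with h1 | h1 | h1
      · exact absurd e (this s t hs ht h1)
      · exact h1
      · exact absurd e.symm (this t s ht hs h1)
    · rw [him, isOpen_iff_mem_nhds]
      rintro _ ⟨t, ht, rfl⟩
      obtain ⟨u, htu, hu⟩ := exists_between ht.2
      exact Filter.mem_of_superset ((hopen u hu).mem_nhds ⟨t, ⟨ht.1, htu⟩, rfl⟩)
        (image_mono (Ico_subset_Ico_right hu.le))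
  have h'0 : h' 0 = g 0 := by
    rw [hh'e ⟨le_rfl, one_pos⟩, hhn 0 ⟨le_rfl, ρpos 0⟩]
    exact (hseq 0).2
  obtain ⟨k, K, k0, hk⟩ := hno h' H' h'0
  apply hk
  have hkF : k '' Ico 0 1 ⊆ ⋃₀ F := subset_sUnion_of_mem ⟨k, K, k0, rfl⟩
  refine hkF.trans ?_
  rw [← hCU, hT, sUnion_range]
  refine iUnion_subset fun n => (hTs n).trans ?_
  rw [him, ← (hhn (n + 1)).image_eq]
  exact image_mono (Ico_subset_Ico_right (ρlt _).le)

theorem nonempty_homeomorph_image_of_injOn_Icc {X : Type*} [TopologicalSpace X] [T2Space X]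
    {h : ℝ → X} {a b : ℝ} (hc : ContinuousOn h (Icc a b)) (hi : InjOn h (Icc a b)) {s : Set ℝ}
    (hs : s ⊆ Icc a b) : Nonempty (h '' s ≃ₜ s) := by
  have h1 : IsEmbedding ((Icc a b).domRestrict h) :=
    ((continuousOn_iff_continuous_domRestrict.1 hc).isClosedEmbedding
      (injOn_iff_injective.1 hi)).isEmbedding
  have h2 : IsEmbedding (s.domRestrict h) := h1.comp (IsEmbedding.inclusion hs)
  exact ⟨(h2.toHomeomorph.trans (Homeomorph.setCongr (range_domRestrict h s))).symm⟩

theorem spaceIsArc_of_image_Icc_eq_univ {X : Type*} [TopologicalSpace X] [T2Space X] {h : ℝ → X}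
    {r : ℝ} (hr : 0 < r) (hc : ContinuousOn h (Icc 0 r)) (hi : InjOn h (Icc 0 r))
    (hu : h '' Icc 0 r = univ) : SpaceIsArc X := by
  obtain ⟨k, kc, ki, -, -, k1, -⟩ := exists_arc_reparam hr one_pos hc hi
  obtain ⟨φ⟩ := nonempty_homeomorph_image_of_injOn_Icc kc ki Subset.rfl
  rw [k1, hu] at φ
  exact ⟨(Homeomorph.Set.univ X).symm.trans φ⟩

/-- An arc issuing from an endpoint of the space is an open ray if its interior is open. -/
theorem isOpenRay_of_isEndpointOf {X : Type*} [TopologicalSpace X] [T2Space X]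
    [ConnectedSpace X] {γ : ℝ → X} (hc : ContinuousOn γ (Icc 0 1)) (hi : InjOn γ (Icc 0 1))
    (ho : IsOpen (γ '' Ioo 0 1)) (he : IsEndpointOf X (γ 0)) : IsOpenRay γ 1 := by
  refine ⟨one_pos, hc, hi, ?_⟩
  set J := γ '' Ioo 0 1 with hJ
  set A := γ '' Icc 0 1 with hA
  have hAc : IsClosed A := (isCompact_Icc.image_of_continuousOn hc).isClosed
  have hJA : J ⊆ A := image_mono Ioo_subset_Icc_self
  have hJp : IsPreconnected J := isPreconnected_Ioo.image _ (hc.mono Ioo_subset_Icc_self)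
  have h0J : γ 0 ∈ closure J := by
    have := ContinuousOn.image_closure (f := γ) (s := Ioo 0 1)
      (by rw [closure_Ioo zero_ne_one]; exact hc)
    rw [closure_Ioo zero_ne_one] at this
    exact this ⟨0, by simp, rfl⟩
  have hm : γ (1 / 2) ∈ J := ⟨1 / 2, by norm_num, rfl⟩
  have hne : ∀ s ∈ Icc (0 : ℝ) 1, s ≠ 0 → γ 0 ≠ γ s := fun s hs hs0 e =>
    hs0 (hi (by simp) hs e).symm
  have h1J : γ 1 ∉ J := by
    rintro ⟨s, hs, e⟩
    exact hs.2.ne (hi (Ioo_subset_Icc_self hs) (by simp) e)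
  have key : ∀ U, IsOpen U → γ 0 ∈ U → ∃ V, IsOpen V ∧ γ 0 ∈ V ∧ V ⊆ U ∧ γ 1 ∉ closure V ∧
      closure V ⊆ V ∪ J := by
    intro U hU h0U
    obtain ⟨V, hV, h0V, hVU, y, hy⟩ := he (U \ {γ 1, γ (1 / 2)})
      (hU.sdiff (Set.toFinite _).isClosed)
      ⟨h0U, by
        rintro (h | h)
        exacts [hne 1 (by simp) (by simp) h, hne (1 / 2) (by norm_num) (by norm_num) h]⟩
    have hcl : closure V = V ∪ {y} := by
      rw [closure_eq_self_union_frontier, hy]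
    have hyJ : y ∈ J := by
      by_contra hyJ
      have : J ⊆ V := by
        refine hJp.subset_of_inter_closed_subset hV isClosed_closure subset_closure ?_ ?_
        · rintro x ⟨hx, hx'⟩
          rw [hcl] at hx'
          rcases hx' with hx' | rfl
          · exact hx'
          · exact absurd hx hyJ
        · obtain ⟨z, hz, hz'⟩ := mem_closure_iff.1 h0J V hV h0V
          exact ⟨z, hz', hz⟩
      have h3 := (hVU (this hm)).2
      simp at h3
    refine ⟨V, hV, h0V, fun x hx => (hVU hx).1, ?_, ?_⟩
    · rw [hcl]
      rintro (h1 | h1)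
      · have h3 := (hVU h1).2
        simp at h3
      · exact h1J (h1 ▸ hyJ)
    · rw [hcl]
      exact union_subset_union_right _ (singleton_subset_iff.2 hyJ)
  have hAJ : A ⊆ J ∪ {γ 0, γ 1} := by
    rintro _ ⟨s, hs, rfl⟩
    rcases hs.1.eq_or_lt with rfl | h0
    · right; simp
    rcases hs.2.eq_or_lt with rfl | h1
    · right; simp
    exact Or.inl ⟨s, ⟨h0, h1⟩, rfl⟩
  obtain ⟨V, hV, h0V, -, h1V, hVJ⟩ := key univ isOpen_univ trivial
  have hVA : V ⊆ A := by
    intro x hxV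
    by_contra hxA
    have hx0 : γ 0 ≠ x := by
      rintro rfl
      exact hxA ⟨0, by simp, rfl⟩
    obtain ⟨W, hW, h0W, hWx, -, hWJ⟩ := key {x}ᶜ isOpen_compl_singleton (by simpa using hx0)
    have e1 : (V ∩ Aᶜ) \ W = (V ∩ Aᶜ) \ closure W := by
      ext z
      constructor
      · rintro ⟨hz, hzW⟩
        refine ⟨hz, fun hz' => ?_⟩
        rcases hWJ hz' with h | h
        · exact hzW h
        · exact hz.2 (hJA h)
      · rintro ⟨hz, hzW⟩
        exact ⟨hz, fun h => hzW (subset_closure h)⟩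
    have e2 : (V ∩ Aᶜ) \ W = (closure V ∩ Jᶜ) \ W ∩ (closure V ∩ closure Aᶜ) := by
      ext z
      constructor
      · rintro ⟨hz, hzW⟩
        exact ⟨⟨⟨subset_closure hz.1, fun h => hz.2 (hJA h)⟩, hzW⟩, subset_closure hz.1,
          subset_closure hz.2⟩
      · rintro ⟨⟨⟨hz, hzJ⟩, hzW⟩, -, hzA⟩
        have hzV : z ∈ V := (hVJ hz).resolve_right hzJ
        refine ⟨⟨hzV, fun h => ?_⟩, hzW⟩
        rcases hAJ h with h | rfl | rfl
        · exact hzJ h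
        · exact hzW h0W
        · exact h1V hz
    have hclopen : IsClopen ((V ∩ Aᶜ) \ W) := by
      constructor
      · rw [e2]
        exact ((isClosed_closure.inter ho.isClosed_compl).sdiff hW).inter
          (isClosed_closure.inter isClosed_closure)
      · rw [e1]
        exact (hV.inter hAc.isOpen_compl).sdiff isClosed_closure
    have hu := hclopen.eq_univ ⟨x, ⟨hxV, hxA⟩, fun h => hWx h rfl⟩
    have : γ 0 ∈ (V ∩ Aᶜ) \ W := hu ▸ mem_univ _
    exact this.2 h0W
  have : γ '' Ico 0 1 = J ∪ V := by
    apply subset_antisymm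
    · rintro _ ⟨s, hs, rfl⟩
      rcases hs.1.eq_or_lt with rfl | h0
      · exact Or.inr h0V
      · exact Or.inl ⟨s, ⟨h0, hs.2⟩, rfl⟩
    · rintro x (hx | hx)
      · exact image_mono Ioo_subset_Ico_self hx
      · rcases hAJ (hVA hx) with h | rfl | rfl
        · exact image_mono Ioo_subset_Ico_self h
        · exact ⟨0, by simp, rfl⟩
        · exact absurd (subset_closure hx) h1V
  rw [this]
  exact ho.union hV

/-- If `X` is not an arc, an open map is injective along every open ray. -/
theorem IsOpenRay.comp_isOpenMap {X : Type*} [TopologicalSpace X] [T2Space X]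
    [ConnectedSpace X] (harc : ¬ SpaceIsArc X) {γ : ℝ → X} (H : IsOpenRay γ 1) {f : X → X}
    (hf : Continuous f) (ho : IsOpenMap f) : IsOpenRay (f ∘ γ) 1 := by
  set g := f ∘ γ with hg
  have gc : ContinuousOn g (Icc 0 1) := hf.comp_continuousOn H.cont
  have go : ∀ t, t ≤ 1 → IsOpen (g '' Ico 0 t) := fun t ht => by
    rw [hg, image_comp]
    exact ho _ (isOpen_image_Ico_of_le H.cont H.inj H.isOpen ht)
  refine ⟨one_pos, gc, ?_, go 1 le_rfl⟩
  set B : Set ℝ := {t | t ∈ Icc 0 1 ∧ ∃ s, 0 ≤ s ∧ s < t ∧ g s = g t} with hB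
  have hBu : ∀ t ∈ B, g '' Ico 0 t = univ := by
    rintro t ⟨ht, s, hs, hst, e⟩
    have e' : g '' Ico 0 t = g '' Icc 0 t := by
      apply subset_antisymm (image_mono Ico_subset_Icc_self)
      rintro _ ⟨u, hu, rfl⟩
      rcases hu.2.eq_or_lt with rfl | h1
      · exact ⟨s, ⟨hs, hst⟩, e⟩
      · exact ⟨u, ⟨hu.1, h1⟩, rfl⟩
    refine IsClopen.eq_univ ⟨?_, go t ht.2⟩ ⟨g s, s, ⟨hs, hst⟩, rfl⟩
    rw [e']
    exact (isCompact_Icc.image_of_continuousOn (gc.mono (Icc_subset_Icc_right ht.2))).isClosed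
  have hBi : ∀ T, (∀ t ∈ B, T ≤ t) → InjOn g (Icc 0 1 ∩ Iio T) := by
    intro T hT
    have : ∀ s t, s ∈ Icc (0 : ℝ) 1 ∩ Iio T → t ∈ Icc (0 : ℝ) 1 ∩ Iio T → s < t →
        g s ≠ g t := by
      intro s t hs ht hst e
      exact absurd (hT t ⟨ht.1, s, hs.1.1, hst, e⟩) (not_le.2 ht.2)
    intro s hs t ht e
    rcases lt_trichotomy s t with h | h | h
    · exact absurd e (this s t hs ht h)
    · exact h
    · exact absurd e.symm (this t s ht hs h)
  rcases B.eq_empty_or_nonempty with hBe | hBne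
  · exact (hBi 2 (by simp [hBe])).mono
      (subset_inter Subset.rfl fun x hx => lt_of_le_of_lt hx.2 one_lt_two)
  exfalso
  have hBb : BddBelow B := ⟨0, fun t ht => ht.1.1⟩
  set T := sInf B with hT
  have hTB : ∀ t ∈ B, T ≤ t := fun t ht => csInf_le hBb ht
  have hT0 : 0 ≤ T := le_csInf hBne fun t ht => ht.1.1
  have hT1 : T ≤ 1 := let ⟨t, ht⟩ := hBne; (hTB t ht).trans ht.1.2
  have hTu : g '' Icc 0 T = univ := by
    rw [eq_univ_iff_forall]
    intro x
    by_contra hx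
    set D := Icc (0 : ℝ) 1 ∩ g ⁻¹' {x} with hD
    have hDc : IsClosed D := gc.preimage_isClosed_of_isClosed isClosed_Icc isClosed_singleton
    have hDne : D.Nonempty := by
      obtain ⟨t, ht⟩ := hBne
      obtain ⟨u, hu, e⟩ := (hBu t ht).symm ▸ mem_univ x
      exact ⟨u, ⟨hu.1, hu.2.le.trans ht.1.2⟩, e⟩
    have hDb : BddBelow D := ⟨0, fun t ht => ht.1.1⟩
    have hmem := hDc.csInf_mem hDne hDb
    have hlt : T < sInf D := by
      by_contra hle
      exact hx ⟨sInf D, ⟨hmem.1.1, not_lt.1 hle⟩, hmem.2⟩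
    obtain ⟨t, ht, htD⟩ := exists_lt_of_csInf_lt hBne hlt
    obtain ⟨u, hu, e⟩ := (hBu t ht).symm ▸ mem_univ x
    have : sInf D ≤ u := csInf_le hDb ⟨⟨hu.1, hu.2.le.trans ht.1.2⟩, e⟩
    linarith [hu.2]
  have hTpos : 0 < T := by
    rcases hT0.eq_or_lt with e | e
    · exfalso
      rw [← e, Icc_self, image_singleton] at hTu
      have h0 : γ 0 ∈ ({g 0} : Set X) := hTu ▸ mem_univ _
      have h1 : γ 1 ∈ ({g 0} : Set X) := hTu ▸ mem_univ _
      have h2 : γ 0 = γ 1 := h0.trans h1.symm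
      exact zero_ne_one (H.inj (by simp) (by simp) h2)
    · exact e
  have hinj := hBi T hTB
  by_cases hmem : T ∈ B
  · obtain ⟨-, s, hs, hsT, e⟩ := hmem
    obtain ⟨m, hsm, hmT⟩ := exists_between hsT
    have hnh : g '' Ico 0 m ∈ 𝓝 (g T) :=
      (go m (hmT.le.trans hT1)).mem_nhds ⟨s, ⟨hs, hsm⟩, e⟩
    have hcw : ContinuousWithinAt g (Ioo m T) T :=
      (gc T ⟨hT0, hT1⟩).mono fun x hx => ⟨by linarith [hx.1], hx.2.le.trans hT1⟩
    have : (𝓝[Ioo m T] T).NeBot := by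
      rw [← mem_closure_iff_nhdsWithin_neBot, closure_Ioo hmT.ne]
      exact ⟨hmT.le, le_rfl⟩
    have hev : ∀ᶠ t in 𝓝[Ioo m T] T, g t ∈ g '' Ico 0 m := hcw hnh
    obtain ⟨t, ⟨u, hu, e'⟩, ht⟩ := (hev.and self_mem_nhdsWithin).exists
    have := hinj ⟨⟨hu.1, by linarith [hu.2]⟩, hu.2.trans hmT⟩
      ⟨⟨by linarith [ht.1], by linarith [ht.2]⟩, ht.2⟩ e'
    linarith [hu.2, ht.1]
  · refine harc (spaceIsArc_of_image_Icc_eq_univ hTpos (gc.mono (Icc_subset_Icc_right hT1)) ?_ hTu)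
    have : ∀ s t, s ∈ Icc (0 : ℝ) T → t ∈ Icc (0 : ℝ) T → s < t → g s ≠ g t := by
      intro s t hs ht hst e
      have htB : t ∈ B := ⟨⟨ht.1, ht.2.trans hT1⟩, s, hs.1, hst, e⟩
      exact hmem (le_antisymm ht.2 (hTB t htB) ▸ htB)
    intro s hs t ht e
    rcases lt_trichotomy s t with h | h | h
    · exact absurd e (this s t hs ht h)
    · exact h
    · exact absurd e.symm (this t s ht hs h)

theorem IsOpenRay.isEndpointOf {X : Type*} [TopologicalSpace X] [T2Space X] {h : ℝ → X} {r : ℝ}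
    (H : IsOpenRay h r) : IsEndpointOf X (h 0) := by
  intro U hU h0
  have hn : h ⁻¹' U ∈ 𝓝[Icc 0 r] 0 := H.cont 0 ⟨le_rfl, H.pos.le⟩ (hU.mem_nhds h0)
  obtain ⟨ε, hε, hεU⟩ := Metric.mem_nhdsWithin_iff.1 hn
  have hδ : 0 < min r (ε / 2) := lt_min H.pos (by linarith)
  have D := H.mono hδ (min_le_left _ _)
  refine ⟨_, D.isOpen, ⟨0, ⟨le_rfl, hδ⟩, rfl⟩, ?_, h (min r (ε / 2)), ?_⟩
  · rintro _ ⟨s, hs, rfl⟩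
    have h1 := hs.2.le.trans (min_le_left _ _)
    have h2 := hs.2.le.trans (min_le_right r (ε / 2))
    refine hεU ⟨?_, hs.1, h1⟩
    rw [Metric.mem_ball, Real.dist_eq, sub_zero, abs_of_nonneg hs.1]
    linarith
  · rw [D.isOpen.frontier_eq]
    apply subset_antisymm
    · rintro x ⟨hx, hx'⟩
      exact D.eq_of_mem_closure hx hx'
    · rintro _ rfl
      refine ⟨?_, D.notMem_image⟩
      rw [D.closure_image]
      exact ⟨_, ⟨hδ.le, le_rfl⟩, rfl⟩

/-- A greatest open ray cannot be crossed at its far end by an open interval. -/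
theorem IsOpenRay.not_exists_cross {X : Type*} [TopologicalSpace X] [T2Space X] {h k : ℝ → X}
    {c : ℝ} (H : IsOpenRay h 1)
    (hmax : ∀ l, IsOpenRay l 1 → l 0 = h 0 → l '' Ico 0 1 ⊆ h '' Ico 0 1)
    (kc : ContinuousOn k (Ioo 0 1)) (ki : InjOn k (Ioo 0 1))
    (ko : ∀ U ⊆ Ioo (0 : ℝ) 1, IsOpen U → IsOpen (k '' U)) (h0 : h 0 ∉ k '' Ioo 0 1)
    (hc : c ∈ Ioo (0 : ℝ) 1) (hkc : k c = h 1)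
    (hP : IsPreconnected (Ioo 0 1 ∩ k ⁻¹' (h '' Ioo 0 1)))
    (hlt : ∀ t ∈ Ioo 0 1 ∩ k ⁻¹' (h '' Ioo 0 1), t < c) : False := by
  have hmeet : ∀ y, 0 ≤ y → y < c → ∃ x ∈ Ioo 0 1 ∩ k ⁻¹' (h '' Ioo 0 1), y < x := by
    intro y hy hyc
    have hcl : h 1 ∈ closure (h '' Ioo 0 1) := by
      rw [H.closure_image_Ioo]; exact ⟨1, by simp, rfl⟩
    obtain ⟨_, ⟨x, hx, rfl⟩, hx'⟩ := mem_closure_iff.1 hcl (k '' Ioo y 1)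
      (ko _ (Ioo_subset_Ioo_left hy) isOpen_Ioo) ⟨c, ⟨hyc, hc.2⟩, hkc⟩
    exact ⟨x, ⟨⟨hy.trans_lt hx.1, hx.2⟩, hx'⟩, hx.1⟩
  obtain ⟨x, hx, -⟩ := hmeet 0 le_rfl hc.1
  have hxc := hlt x hx
  have hin : ∀ y ∈ Ioo x c, k y ∈ h '' Ioo 0 1 := by
    intro y hy
    obtain ⟨z, hz, hyz⟩ := hmeet y (hx.1.1.le.trans hy.1.le) hy.2
    exact (hP.ordConnected.out hx hz ⟨hy.1.le, hyz.le⟩).2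
  obtain ⟨d, hcd, hd1⟩ := exists_between hc.2
  have hsub : Icc c d ⊆ Ioo 0 1 := fun y hy => ⟨hc.1.trans_le hy.1, hy.2.trans_lt hd1⟩
  obtain ⟨k', k'c, k'i, k'0, -, k'1, k'2⟩ :=
    exists_arc_reparam hcd one_lt_two (kc.mono hsub) (ki.mono hsub)
  have hun : h '' Ico 0 1 ∪ k' '' Ico 1 2 = h '' Ico 0 1 ∪ k '' Ioo x d := by
    rw [k'2, ← Ioo_union_Ico_eq_Ioo hxc hcd.le, image_union, ← union_assoc]
    congr 1
    refine (union_eq_self_of_subset_right ?_).symm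
    rintro _ ⟨y, hy, rfl⟩
    exact image_mono Ioo_subset_Ico_self (hin y hy)
  obtain ⟨g, G, ge, gi⟩ := H.glue one_lt_two k'c k'i (k'0.trans hkc) (by
    intro t ht
    have : k' t ∈ k '' Icc c d := k'1 ▸ mem_image_of_mem _ ht
    obtain ⟨u, hu, e⟩ := this
    rw [← e]
    rintro ⟨s, hs, e'⟩
    rcases hs.1.eq_or_lt with rfl | hs0
    · exact h0 ⟨u, hsub hu, e'.symm⟩
    · exact absurd (hlt u ⟨hsub hu, s, ⟨hs0, hs.2⟩, e'⟩) (not_lt.2 hu.1))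
    (by
      rw [hun]
      exact H.isOpen.union
        (ko _ (fun y hy => ⟨hx.1.1.trans hy.1, hy.2.trans hd1⟩) isOpen_Ioo))
  obtain ⟨l, L, l0, -, li⟩ := G.rescale one_pos
  apply H.notMem_image
  apply hmax l L (l0.trans (ge ⟨le_rfl, zero_le_one⟩))
  rw [li, ← ge ⟨zero_le_one, le_rfl⟩]
  exact ⟨1, ⟨zero_le_one, one_lt_two⟩, rfl⟩

theorem IsFreeOpenInterval.exists_param {X : Type*} [TopologicalSpace X] {K : Set X}
    (hK : IsFreeOpenInterval K) : ∃ k : ℝ → X, ContinuousOn k (Ioo 0 1) ∧ InjOn k (Ioo 0 1) ∧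
      k '' Ioo 0 1 = K ∧ ∀ U ⊆ Ioo (0 : ℝ) 1, IsOpen U → IsOpen (k '' U) := by
  obtain ⟨hKo, ⟨φ⟩⟩ := hK
  set ψ : Ioo (0 : ℝ) 1 → X := fun t => (φ.symm t : X) with hψ
  have hψo : IsOpenEmbedding ψ := hKo.isOpenEmbedding_subtypeVal.comp φ.symm.isOpenEmbedding
  have : Nonempty X := ⟨ψ ⟨1 / 2, by norm_num⟩⟩
  obtain ⟨k, hk⟩ : ∃ k : ℝ → X, (Ioo 0 1).domRestrict k = ψ :=
    ⟨fun t => if ht : t ∈ Ioo (0 : ℝ) 1 then ψ ⟨t, ht⟩ else this.some, by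
      ext t
      rw [domRestrict_apply, dif_pos t.2]⟩
  refine ⟨k, ?_, ?_, ?_, ?_⟩
  · rw [continuousOn_iff_continuous_domRestrict, hk]; exact hψo.continuous
  · rw [injOn_iff_injective, hk]; exact hψo.injective
  · rw [← range_domRestrict, hk]
    ext x
    constructor
    · rintro ⟨t, rfl⟩
      exact (φ.symm t).2
    · intro hx
      exact ⟨φ ⟨x, hx⟩, by simp [hψ]⟩
  · intro U hU hUo
    have : k '' U = ψ '' (Subtype.val ⁻¹' U) := by
      rw [← hk, domRestrict_eq, image_comp, Subtype.image_preimage_coe,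
        inter_eq_self_of_subset_right hU]
    rw [this]
    exact hψo.isOpenMap _ (hUo.preimage continuous_subtype_val)

theorem isPreconnected_inter_preimage_of_isOpen_image {X : Type*} [TopologicalSpace X]
    {k : ℝ → X} {I : Set ℝ} {S : Set X} (hI : IsOpen I) (ki : InjOn k I)
    (ko : ∀ U ⊆ I, IsOpen U → IsOpen (k '' U)) (hS : IsPreconnected S) (hSk : S ⊆ k '' I) :
    IsPreconnected (I ∩ k ⁻¹' S) := by
  have hom : IsOpenMap (I.domRestrict k) := by
    intro U hU
    rw [domRestrict_eq, image_comp]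
    exact ko _ (Subtype.coe_image_subset _ _) (hI.isOpenMap_subtype_val _ hU)
  have := (hS.preimage_of_isOpenMap (injOn_iff_injective.1 ki) hom
    (by rwa [range_domRestrict])).image _ continuous_subtype_val.continuousOn
  rwa [domRestrict_eq, preimage_comp, Subtype.image_preimage_coe] at this

/-- The interior of a greatest open ray is a maximal free open interval of Type I. -/
theorem IsOpenRay.isTypeI {X : Type*} [TopologicalSpace X] [T2Space X] {h : ℝ → X}
    (H : IsOpenRay h 1)
    (hmax : ∀ l, IsOpenRay l 1 → l 0 = h 0 → l '' Ico 0 1 ⊆ h '' Ico 0 1) :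
    IsTypeI (h '' Ioo 0 1) := by
  have hopen : IsOpen (h '' Ioo 0 1) :=
    isOpen_image_Ioo_of_le le_rfl (H.cont.mono Ico_subset_Icc_self)
      (H.inj.mono Ico_subset_Icc_self) H.isOpen
  have h0 : h 0 ∉ h '' Ioo 0 1 := by
    rintro ⟨s, hs, e⟩
    exact hs.1.ne' (H.inj (Ioo_subset_Icc_self hs) (by simp) e)
  have h1 : h 1 ∉ h '' Ioo 0 1 := fun hh => H.notMem_image (image_mono Ioo_subset_Ico_self hh)
  have hpre : IsPreconnected (h '' Ioo 0 1) :=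
    isPreconnected_Ioo.image _ (H.cont.mono Ioo_subset_Icc_self)
  have hIcc : h '' Icc 0 1 = h '' Ioo 0 1 ∪ {h 0, h 1} := by
    rw [← Ioo_union_both zero_le_one, image_union, image_pair]
  refine ⟨⟨⟨hopen, nonempty_homeomorph_image_of_injOn_Icc H.cont H.inj Ioo_subset_Icc_self⟩, ?_⟩,
    h 0, h 1, ?_, h0, h1, ?_, ?_, Or.inl H.isEndpointOf⟩
  · intro K hK hsub
    obtain ⟨k, kc, ki, rfl, ko⟩ := hK.exists_param
    apply hsub.antisymm
    by_contra hn
    have hPc := isPreconnected_inter_preimage_of_isOpen_image isOpen_Ioo ki ko hpre hsub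
    have hnot0 : h 0 ∉ k '' Ioo 0 1 := by
      rintro ⟨c, hc, hkc⟩
      have hQ : IsOpen (Ioo 0 1 ∩ k ⁻¹' (h '' Ico 0 1)) :=
        kc.isOpen_inter_preimage isOpen_Ioo H.isOpen
      have hcQ : c ∈ Ioo 0 1 ∩ k ⁻¹' (h '' Ico 0 1) := ⟨hc, 0, by simp, hkc.symm⟩
      have hQP : ∀ x ∈ Ioo 0 1 ∩ k ⁻¹' (h '' Ico 0 1), x ≠ c →
          x ∈ Ioo 0 1 ∩ k ⁻¹' (h '' Ioo 0 1) := by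
        rintro x ⟨hx, s, hs, e⟩ hxc
        refine ⟨hx, s, ⟨hs.1.lt_of_ne ?_, hs.2⟩, e⟩
        rintro rfl
        exact hxc (ki hx hc (e.symm.trans hkc.symm))
      obtain ⟨ε, hε, hεQ⟩ := Metric.isOpen_iff.1 hQ c hcQ
      rw [Real.ball_eq_Ioo] at hεQ
      have m1 := hQP (c - ε / 2) (hεQ ⟨by linarith, by linarith⟩) (by linarith)
      have m2 := hQP (c + ε / 2) (hεQ ⟨by linarith, by linarith⟩) (by linarith)
      have := hPc.ordConnected.out m1 m2 (show c ∈ _ from ⟨by linarith, by linarith⟩)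
      exact h0 (hkc ▸ this.2)
    obtain ⟨c, hc, hkc⟩ : h 1 ∈ k '' Ioo 0 1 := by
      by_contra hn1
      refine hn ((isPreconnected_Ioo.image _ kc).subset_of_inter_closed_subset hopen
        isClosed_closure subset_closure ?_ ?_)
      · rintro x ⟨hx, hx'⟩
        rw [H.closure_image_Ioo, hIcc] at hx'
        rcases hx' with h | rfl | rfl
        · exact h
        · exact absurd hx hnot0
        · exact absurd hx hn1
      · have hm : h (1 / 2) ∈ h '' Ioo 0 1 := ⟨1 / 2, by norm_num, rfl⟩
        exact ⟨_, hsub hm, hm⟩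
    have hcP : c ∉ Ioo 0 1 ∩ k ⁻¹' (h '' Ioo 0 1) := fun hh => h1 (hkc ▸ hh.2)
    by_cases hlt : ∀ t ∈ Ioo 0 1 ∩ k ⁻¹' (h '' Ioo 0 1), t < c
    · exact H.not_exists_cross hmax kc ki ko hnot0 hc hkc hPc hlt
    · push Not at hlt
      obtain ⟨t, ht, hct⟩ := hlt
      have hgt : ∀ s ∈ Ioo 0 1 ∩ k ⁻¹' (h '' Ioo 0 1), c < s := by
        intro s hs
        by_contra hsc
        exact hcP (hPc.ordConnected.out hs ht ⟨not_lt.1 hsc, hct⟩)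
      have hr : ∀ x : ℝ, x ∈ Ioo (0 : ℝ) 1 → 1 - x ∈ Ioo (0 : ℝ) 1 := fun x hx =>
        ⟨by linarith [hx.2], by linarith [hx.1]⟩
      set k' : ℝ → X := fun x => k (1 - x) with hk'
      have him : ∀ U, k' '' U = k '' ((fun x => 1 - x) '' U) := fun U => by
        rw [image_image]
      have k'i : InjOn k' (Ioo 0 1) := fun x hx y hy e => by
        linarith [ki (hr x hx) (hr y hy) e]
      have k'o : ∀ U ⊆ Ioo (0 : ℝ) 1, IsOpen U → IsOpen (k' '' U) := by
        intro U hU hUo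
        rw [him]
        refine ko _ ?_ ((Homeomorph.subLeft (1 : ℝ)).isOpenMap _ hUo)
        rintro _ ⟨x, hx, rfl⟩
        exact hr x (hU hx)
      have k'im : k' '' Ioo 0 1 = k '' Ioo 0 1 := by
        rw [him, image_const_sub_Ioo]; norm_num
      refine H.not_exists_cross (k := k') (c := 1 - c) hmax
        (kc.comp (by fun_prop) hr) k'i k'o (k'im ▸ hnot0) (hr c hc) (by simp [hk', hkc])
        (isPreconnected_inter_preimage_of_isOpen_image isOpen_Ioo k'i k'o hpre (k'im ▸ hsub)) ?_
      rintro s ⟨hs, hs'⟩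
      linarith [hgt (1 - s) ⟨hr s hs, hs'⟩]
  · exact fun e => zero_ne_one (H.inj (by simp) (by simp) e)
  · rw [H.closure_image_Ioo, hIcc]
  · exact ⟨h, H.cont, H.inj, H.closure_image_Ioo.symm, rfl, rfl⟩

/-- For `X` a Peano continuum having a free arc, neither an arc
nor a circle, a maximal free open interval `J` of Type I and a continuous open
map `f : X → X`, there is a maximal free open interval `K` of Type I with
`f(J) ⊆ K`, and `f` is injective on `J`. -/
theorem stmt_13 (X : Type*) [MetricSpace X] [CompactSpace X] [ConnectedSpace X]
    [LocallyConnectedSpace X]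
    (hfree : ∃ A : Set X, IsFreeArc A)
    (harc : ¬ SpaceIsArc X) (hcirc : ¬ SpaceIsCircle X)
    (J : Set X) (hJ : IsTypeI J)
    (f : X → X) (hc : Continuous f) (ho : IsOpenMap f) :
    ∃ K : Set X, IsTypeI K ∧ f '' J ⊆ K ∧ Set.InjOn f J := by
  obtain ⟨⟨⟨hJo, -⟩, -⟩, a, b, hab, haJ, hbJ, hcl, harcJ, hend⟩ := hJ
  obtain ⟨γ, γ0, γ1, γJ, hγ⟩ : ∃ γ : ℝ → X, ContinuousOn γ (Icc 0 1) ∧ InjOn γ (Icc 0 1) ∧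
      γ '' Ioo 0 1 = J ∧ IsEndpointOf X (γ 0) := by
    obtain ⟨γ, γc, γi, γim, rfl, rfl⟩ := harcJ
    have hJe : γ '' Ioo 0 1 = J := by
      rw [← Icc_sdiff_both, γi.image_sdiff_subset (by simp [insert_subset_iff]), γim, hcl, image_pair]
      rw [union_sdiff_right, sdiff_eq_left, disjoint_right]
      rintro x (rfl | rfl) <;> assumption
    rcases hend with h | h
    · exact ⟨γ, γc, γi, hJe, h⟩
    · have hr : MapsTo (fun x : ℝ => 1 - x) (Icc 0 1) (Icc 0 1) := fun x hx =>
        ⟨by linarith [hx.2], by linarith [hx.1]⟩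
      refine ⟨fun x => γ (1 - x), γc.comp (by fun_prop) hr, fun x hx y hy e => ?_, ?_, by simpa⟩
      · linarith [γi (hr hx) (hr hy) e]
      · rw [← image_image γ (fun x => 1 - x), image_const_sub_Ioo]
        simpa using hJe
  have G : IsOpenRay (f ∘ γ) 1 :=
    (isOpenRay_of_isEndpointOf γ0 γ1 (γJ ▸ hJo) hγ).comp_isOpenMap harc hc ho
  obtain ⟨h, H, h0, hmax⟩ := exists_greatest_isOpenRay G
  refine ⟨h '' Ioo 0 1, H.isTypeI (h0 ▸ hmax), ?_, ?_⟩
  · rw [← γJ, ← image_comp]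
    rintro _ ⟨s, hs, rfl⟩
    obtain ⟨t, ht, e⟩ := hmax _ G rfl ⟨s, Ioo_subset_Ico_self hs, rfl⟩
    refine ⟨t, ⟨ht.1.lt_of_ne ?_, ht.2⟩, e⟩
    rintro rfl
    exact hs.1.ne (G.inj (by simp) (Ioo_subset_Icc_self hs) (h0.symm.trans e))
  · rw [← γJ]
    rintro _ ⟨s, hs, rfl⟩ _ ⟨t, ht, rfl⟩ e
    rw [G.inj (Ioo_subset_Icc_self hs) (Ioo_subset_Icc_self ht) e]
end

section
/- Let X be a Peano continuum having a free arc, which is neither an arc nor a circle, possessing at least one maximal free open interval of Type I, and let F be a commutative subsemigroup of C^0(X) consisting of continuous open maps that is sensitive with sensitivity constant c > 0. Then there exist a free arc A_1 of X and f_1 ∈ F such that A_1 is a jumping arc of {f_1}, with A_1 and f_1(A_1) contained in the same maximal free open interval of Type I. -/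
open Set Metric Topology

open scoped NNReal

/-- A preconnected set meeting but not contained in an initial segment of an open ray
contains the frontier point of that segment. -/
theorem IsPreconnected.apply_mem_of_ray {X : Type*} [TopologicalSpace X] [T2Space X]
    {φ : ℝ≥0 → X} (hφ : IsOpenEmbedding φ) {C : Set X} (hC : IsPreconnected C) {t : ℝ≥0}
    {x y : X} (hx : x ∈ C) (hxt : x ∈ φ '' Iio t) (hy : y ∈ C) (hyt : y ∉ φ '' Iio t) :
    φ t ∈ C := by
  by_contra hmem
  have h1 : IsOpen (φ '' Iio t) := hφ.isOpenMap _ isOpen_Iio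
  have h2 : IsOpen (φ '' Iic t)ᶜ := by
    have : IsCompact (Iic t) := by
      rw [← Set.Icc_bot]; exact isCompact_Icc
    exact (this.image hφ.continuous).isClosed.isOpen_compl
  have key : ∀ z ∈ C, z ∉ φ '' Iio t → z ∈ (φ '' Iic t)ᶜ := by
    rintro z hz hzt ⟨s, hs, rfl⟩
    rcases (show s ≤ t from hs).lt_or_eq with h | rfl
    · exact hzt ⟨s, h, rfl⟩
    · exact hmem hz
  obtain ⟨z, -, ⟨s, hs, rfl⟩, hz2⟩ := hC _ _ h1 h2
    (fun z hz => by
      by_cases h : z ∈ φ '' Iio t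
      · exact Or.inl h
      · exact Or.inr (key z hz h)) ⟨x, hx, hxt⟩ ⟨y, hy, key y hy hyt⟩
  exact hz2 ⟨s, (show s < t from hs).le, rfl⟩

/-- The origin of an open ray does not lie on an open set modelled on an order without
endpoints. -/
theorem ray_zero_notMem_range {X α : Type*} [TopologicalSpace X] [LinearOrder α]
    [TopologicalSpace α] [OrderTopology α] [DenselyOrdered α] [NoMinOrder α] [NoMaxOrder α]
    {φ : ℝ≥0 → X} (hφ : IsOpenEmbedding φ) {e : α → X} (he : IsOpenEmbedding e) :
    φ 0 ∉ range e := by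
  rintro ⟨s, hs⟩
  have hopen : IsOpen (φ ⁻¹' range e) := he.isOpen_range.preimage hφ.continuous
  have h0 : (0 : ℝ≥0) ∈ φ ⁻¹' range e := ⟨s, hs⟩
  obtain ⟨t, ht, hts⟩ := exists_Ico_subset_of_mem_nhds (hopen.mem_nhds h0) ⟨1, zero_lt_one⟩
  have hB : IsOpen (e ⁻¹' (φ '' Iio t)) := (hφ.isOpenMap _ isOpen_Iio).preimage he.continuous
  have hsB : s ∈ e ⁻¹' (φ '' Iio t) := ⟨0, ht, hs.symm⟩
  have hconn : IsPreconnected (e ⁻¹' (φ '' Ioo 0 t)) := by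
    apply (isPreconnected_Ioo.image φ hφ.continuous.continuousOn).preimage_of_isOpenMap
      he.injective he.isOpenMap
    rintro _ ⟨r, hr, rfl⟩
    exact hts ⟨hr.1.le, hr.2⟩
  have hne : ∀ x, x ≠ s → x ∈ e ⁻¹' (φ '' Iio t) → x ∈ e ⁻¹' (φ '' Ioo 0 t) := by
    rintro x hx ⟨r, hr, hrx⟩
    refine ⟨r, ⟨pos_iff_ne_zero.2 ?_, hr⟩, hrx⟩
    rintro rfl
    exact hx (he.injective (by rw [← hrx, hs]))
  obtain ⟨l, u, hlu, hsub⟩ := mem_nhds_iff_exists_Ioo_subset.1 (hB.mem_nhds hsB)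
  obtain ⟨x, hx1, hx2⟩ := exists_between hlu.1
  obtain ⟨y, hy1, hy2⟩ := exists_between hlu.2
  obtain ⟨r, hr, hrs⟩ := hconn.ordConnected.out
    (hne x hx2.ne (hsub ⟨hx1, hx2.trans hlu.2⟩)) (hne y hy1.ne' (hsub ⟨hlu.1.trans hy1, hy2⟩))
    ⟨hx2.le, hy1.le⟩
  rw [hs] at hrs
  exact hr.1.ne' (hφ.injective hrs)

/-- Distinct open rays do not start in each other's interior. -/
theorem eq_zero_of_ray_apply_eq_ray_zero {X : Type*} [TopologicalSpace X]
    {φ ψ : ℝ≥0 → X} (hφ : IsOpenEmbedding φ) (hψ : IsOpenEmbedding ψ) {s : ℝ≥0}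
    (h : φ s = ψ 0) : s = 0 := by
  by_contra hs
  have he : IsOpenEmbedding (fun x : Ioi (0 : ℝ≥0) => φ x) :=
    hφ.comp (isOpen_Ioi.isOpenEmbedding_subtypeVal)
  exact ray_zero_notMem_range hψ he ⟨⟨s, pos_iff_ne_zero.2 hs⟩, h⟩

/-- In a compact connected space that is not an arc, continuous open maps from a half-line
are open embeddings. -/
theorem isOpenEmbedding_of_not_spaceIsArc {X : Type*} [TopologicalSpace X] [T2Space X]
    [CompactSpace X] [ConnectedSpace X] [Nontrivial X] (harc : ¬ SpaceIsArc X) {ψ : ℝ≥0 → X}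
    (hc : Continuous ψ) (ho : IsOpenMap ψ) : IsOpenEmbedding ψ := by
  refine .of_continuous_injective_isOpenMap hc ?_ ho
  have hfull : ∀ s t, s < t → ψ s = ψ t → ψ '' Iio t = univ := by
    intro s t hst h
    have hcl : IsClosed (ψ '' Iio t) := by
      have : ψ '' Iio t = ψ '' Icc 0 t := by
        apply Subset.antisymm
        · exact image_mono fun r hr => ⟨zero_le, (show r < t from hr).le⟩
        · rintro _ ⟨r, hr, rfl⟩
          rcases hr.2.lt_or_eq with h' | rfl
          · exact ⟨r, h', rfl⟩
          · exact ⟨s, hst, h⟩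
      rw [this]
      exact (isCompact_Icc.image hc).isClosed
    exact IsClopen.eq_univ ⟨hcl, ho _ isOpen_Iio⟩ ⟨_, s, hst, rfl⟩
  by_contra hinj
  have hT : ({t | ψ '' Iic t = univ} : Set ℝ≥0).Nonempty := by
    simp only [Function.Injective, not_forall] at hinj
    obtain ⟨s, t, hst, hne⟩ := hinj
    rcases lt_or_gt_of_ne hne with h | h
    · exact ⟨t, eq_univ_of_univ_subset (hfull s t h hst ▸ image_mono Iio_subset_Iic_self)⟩
    · exact ⟨s, eq_univ_of_univ_subset (hfull t s h hst.symm ▸ image_mono Iio_subset_Iic_self)⟩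
  set T : Set ℝ≥0 := {t | ψ '' Iic t = univ} with hTdef
  set τ := sInf T with hτ
  have hsurj : ∀ x, ∃ s ≤ τ, ψ s = x := by
    intro x
    have hcl : IsClosed (ψ ⁻¹' {x}) := isClosed_singleton.preimage hc
    have hx : ∀ t ∈ T, ∃ s ≤ t, ψ s = x := fun t ht => by
      have : x ∈ ψ '' Iic t := by rw [show ψ '' Iic t = univ from ht]; trivial
      exact this
    obtain ⟨t, ht⟩ := hT
    obtain ⟨s, -, hs⟩ := hx t ht
    refine ⟨sInf (ψ ⁻¹' {x}), ?_, hcl.csInf_mem ⟨s, hs⟩ (OrderBot.bddBelow _)⟩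
    refine le_csInf ⟨t, ht⟩ fun t' ht' => ?_
    obtain ⟨s', hs', hsx⟩ := hx t' ht'
    exact (csInf_le (OrderBot.bddBelow _) (show s' ∈ ψ ⁻¹' {x} from hsx)).trans hs'
  have hnot : ∀ t < τ, ψ '' Iio t ≠ univ := fun t ht h =>
    ht.not_ge (csInf_le (OrderBot.bddBelow _)
      (eq_univ_of_univ_subset (h ▸ image_mono Iio_subset_Iic_self)))
  have hnotτ : ψ '' Iio τ ≠ univ := by
    intro h
    have : Nonempty (Iio τ) := by
      obtain ⟨x⟩ := (inferInstance : Nonempty X)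
      have hx : x ∈ ψ '' Iio τ := by rw [h]; trivial
      obtain ⟨s, hs, rfl⟩ := hx
      exact ⟨⟨s, hs⟩⟩
    obtain ⟨t, ht⟩ := isCompact_univ.elim_directed_cover (fun t : Iio τ => ψ '' Iio (t : ℝ≥0))
      (fun t => ho _ isOpen_Iio)
      (by
        intro x _
        have hx : x ∈ ψ '' Iio τ := by rw [h]; trivial
        obtain ⟨s, hs, rfl⟩ := hx
        obtain ⟨r, h1, h2⟩ := exists_between (show s < τ from hs)
        exact mem_iUnion.2 ⟨⟨r, h2⟩, s, h1, rfl⟩)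
      (by
        intro a b
        rcases le_total a b with hab | hab
        · exact ⟨b, image_mono (Iio_subset_Iio hab), subset_rfl⟩
        · exact ⟨a, subset_rfl, image_mono (Iio_subset_Iio hab)⟩)
    exact hnot t t.2 (eq_univ_of_univ_subset ht)
  have hinjτ : InjOn ψ (Iic τ) := by
    have aux : ∀ s t, s < t → t ≤ τ → ψ s ≠ ψ t := by
      intro s t hst ht h
      rcases ht.lt_or_eq with h' | rfl
      · exact hnot t h' (hfull s t hst h)
      · exact hnotτ (hfull s _ hst h)
    intro s hs t ht h
    by_contra hne
    rcases lt_or_gt_of_ne hne with h' | h'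
    · exact aux s t h' ht h
    · exact aux t s h' hs h.symm
  have hτ0 : τ ≠ 0 := by
    intro h0
    obtain ⟨x, y, hxy⟩ := exists_pair_ne X
    obtain ⟨s, hs, rfl⟩ := hsurj x
    obtain ⟨t, ht, rfl⟩ := hsurj y
    rw [h0, nonpos_iff_eq_zero] at hs ht
    exact hxy (by rw [hs, ht])
  let γ : Icc (0 : ℝ) 1 → X := fun r => ψ (Real.toNNReal r * τ)
  have hγ : Continuous γ := by fun_prop
  have hle : ∀ r : Icc (0 : ℝ) 1, Real.toNNReal r * τ ≤ τ := fun r =>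
    mul_le_of_le_one_left zero_le (Real.toNNReal_le_one.2 r.2.2)
  have hbij : Function.Bijective γ := by
    constructor
    · intro r s h
      have := mul_right_cancel₀ hτ0 (hinjτ (hle r) (hle s) h)
      exact Subtype.ext ((Real.toNNReal_eq_toNNReal_iff r.2.1 s.2.1).1 this)
    · intro x
      obtain ⟨s, hs, rfl⟩ := hsurj x
      refine ⟨⟨(s / τ : ℝ≥0), NNReal.coe_nonneg _, ?_⟩, ?_⟩
      · exact_mod_cast div_le_one_of_le₀ hs zero_le
      · simp only [γ, Real.toNNReal_coe]
        rw [div_mul_cancel₀ _ hτ0]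
  exact harc ⟨(isHomeomorph_iff_continuous_bijective.2 ⟨hγ, hbij⟩).homeomorph.symm⟩

/-- Initial segments of open rays with common origin are determined by their last point. -/
theorem image_Iic_subset_of_ray {X : Type*} [TopologicalSpace X] [T2Space X]
    {φ ψ : ℝ≥0 → X} (hφ : IsOpenEmbedding φ) (hψ : IsOpenEmbedding ψ) (h0 : φ 0 = ψ 0)
    {s t : ℝ≥0} (h : φ s = ψ t) : φ '' Iic s ⊆ ψ '' Iic t := by
  rintro _ ⟨r, hr, rfl⟩
  rcases (show r ≤ s from hr).lt_or_eq with hrs | rfl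
  · by_contra hmem
    have hC : IsPreconnected (φ '' Iic r) := isPreconnected_Iic.image φ hφ.continuous.continuousOn
    have ht : 0 < t := by
      rw [pos_iff_ne_zero]
      rintro rfl
      rw [← h0] at h
      exact not_lt_zero (hφ.injective h ▸ hrs)
    obtain ⟨u, hu, hut⟩ := hC.apply_mem_of_ray hψ (t := t) (x := φ 0) (y := φ r)
      ⟨0, mem_Iic.2 zero_le, rfl⟩ ⟨0, ht, h0.symm⟩ ⟨r, self_mem_Iic, rfl⟩
      (fun hm => hmem (image_mono Iio_subset_Iic_self hm))
    rw [← h] at hut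
    exact (hφ.injective hut ▸ hrs).not_ge hu
  · exact ⟨t, self_mem_Iic, h.symm⟩

theorem image_Iic_eq_of_ray {X : Type*} [TopologicalSpace X] [T2Space X]
    {φ ψ : ℝ≥0 → X} (hφ : IsOpenEmbedding φ) (hψ : IsOpenEmbedding ψ) (h0 : φ 0 = ψ 0)
    {s t : ℝ≥0} (h : φ s = ψ t) : φ '' Iic s = ψ '' Iic t :=
  (image_Iic_subset_of_ray hφ hψ h0 h).antisymm (image_Iic_subset_of_ray hψ hφ h0.symm h.symm)

/-- Initial segments of open rays with common origin are comparable. -/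
theorem mem_image_Iic_or_of_ray {X : Type*} [TopologicalSpace X] [T2Space X]
    {φ ψ : ℝ≥0 → X} (hφ : IsOpenEmbedding φ) (hψ : IsOpenEmbedding ψ) (h0 : φ 0 = ψ 0)
    (s t : ℝ≥0) : φ s ∈ ψ '' Iic t ∨ ψ t ∈ φ '' Iic s := by
  by_contra! h
  have hC : IsPreconnected (φ '' Iic s) := isPreconnected_Iic.image φ hφ.continuous.continuousOn
  have ht : 0 < t := by
    rw [pos_iff_ne_zero]
    rintro rfl
    exact h.2 ⟨0, mem_Iic.2 zero_le, h0⟩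
  exact h.2 (hC.apply_mem_of_ray hψ (t := t) (x := φ 0) (y := φ s)
      ⟨0, mem_Iic.2 zero_le, rfl⟩ ⟨0, ht, h0.symm⟩ ⟨s, self_mem_Iic, rfl⟩
      (fun hm => h.1 (image_mono Iio_subset_Iic_self hm)))

/-- A strictly decreasing size function on closed sets, continuous along the initial segments
of paths. -/
theorem exists_continuous_size {X : Type*} [MetricSpace X] [CompactSpace X] [Nonempty X] :
    ∃ H : Set X → ℝ, (∀ K, 0 ≤ H K) ∧
      (∀ K L, IsClosed K → K.Nonempty → K ⊂ L → H L < H K) ∧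
      ∀ φ : ℝ≥0 → X, Continuous φ → Continuous fun t => H (φ '' Iic t) := by
  have hb : ∀ (n : ℕ) (K : Set X), K.Nonempty →
      (1 / 2 : ℝ) ^ n * infDist (TopologicalSpace.denseSeq X n) K
        ≤ (1 / 2 : ℝ) ^ n * diam (univ : Set X) := by
    intro n K ⟨y, hy⟩
    gcongr
    exact (infDist_le_dist_of_mem hy).trans (dist_le_diam_of_mem
      isCompact_univ.isBounded trivial trivial)
  have hs : Summable fun n : ℕ => (1 / 2 : ℝ) ^ n * diam (univ : Set X) :=
    (summable_geometric_two).mul_right _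
  have hsK : ∀ K : Set X, K.Nonempty → Summable fun n : ℕ =>
      (1 / 2 : ℝ) ^ n * infDist (TopologicalSpace.denseSeq X n) K := fun K hK =>
    Summable.of_nonneg_of_le (fun n => mul_nonneg (by positivity) infDist_nonneg)
      (fun n => hb n K hK) hs
  refine ⟨fun K => ∑' n : ℕ, (1 / 2 : ℝ) ^ n * infDist (TopologicalSpace.denseSeq X n) K,
    fun K => tsum_nonneg fun n => mul_nonneg (by positivity) infDist_nonneg, ?_, ?_⟩
  · intro K L hK hne hKL
    obtain ⟨y, hyL, hyK⟩ := exists_of_ssubset hKL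
    have hpos : 0 < infDist y K := (hK.notMem_iff_infDist_pos hne).1 hyK
    obtain ⟨n, hn⟩ := (TopologicalSpace.denseRange_denseSeq X).exists_dist_lt y (half_pos hpos)
    have hlt : infDist (TopologicalSpace.denseSeq X n) L
        < infDist (TopologicalSpace.denseSeq X n) K := by
      have h1 := infDist_le_dist_of_mem (x := TopologicalSpace.denseSeq X n) hyL
      have h2 := infDist_le_infDist_add_dist (s := K) (x := y)
        (y := TopologicalSpace.denseSeq X n)
      rw [dist_comm] at h1
      linarith
    refine Summable.tsum_lt_tsum (i := n) (fun m => ?_) ?_ (hsK L (hne.mono hKL.1)) (hsK K hne)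
    · have := infDist_le_infDist_of_subset (x := TopologicalSpace.denseSeq X m) hKL.1 hne
      show _ ≤ _
      gcongr
    · show _ < _
      gcongr
  · intro φ hφ
    refine continuous_tsum (u := fun n : ℕ => (1 / 2 : ℝ) ^ n * diam (univ : Set X)) (fun n => ?_)
      hs (fun n t => ?_)
    · refine continuous_const.mul ?_
      have hcont := (isCompact_Icc (a := (0 : ℝ≥0)) (b := 1)).continuous_sInf
        (f := fun (t r : ℝ≥0) => dist (TopologicalSpace.denseSeq X n) (φ (r * t))) (by
          change Continuous fun p : ℝ≥0 × ℝ≥0 =>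
            dist (TopologicalSpace.denseSeq X n) (φ (p.2 * p.1))
          fun_prop)
      convert hcont using 2 with t
      have himg : φ '' Iic t = (fun r => φ (r * t)) '' Icc 0 1 := by
        ext x
        constructor
        · rintro ⟨s, hs, rfl⟩
          rcases eq_or_ne t 0 with rfl | ht
          · exact ⟨0, ⟨le_rfl, zero_le⟩, by simp [nonpos_iff_eq_zero.1 (show s ≤ 0 from hs)]⟩
          · exact ⟨s / t, ⟨zero_le, div_le_one_of_le₀ hs zero_le⟩, by simp [div_mul_cancel₀ _ ht]⟩
        · rintro ⟨r, hr, rfl⟩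
          exact ⟨r * t, mul_le_of_le_one_left zero_le hr.2, rfl⟩
      rw [infDist_eq_iInf, himg, ← sInf_image', image_image]
    · rw [Real.norm_of_nonneg (mul_nonneg (by positivity) infDist_nonneg)]
      exact hb n _ ⟨φ 0, 0, mem_Iic.2 zero_le, rfl⟩

theorem StrictMono.isOpenEmbedding_nnreal {f : ℝ≥0 → ℝ≥0} (hm : StrictMono f)
    (hc : Continuous f) (h0 : f 0 = 0) : IsOpenEmbedding f := by
  have hr : range f = ⋃ t, Iio (f t) := by
    ext y
    simp only [mem_iUnion, mem_Iio]
    constructor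
    · rintro ⟨t, rfl⟩
      exact ⟨t + 1, hm (lt_add_one t)⟩
    · rintro ⟨t, ht⟩
      obtain ⟨s, -, hs⟩ := intermediate_value_Icc (zero_le : 0 ≤ t) hc.continuousOn
        ⟨h0.trans_le zero_le, ht.le⟩
      exact ⟨s, hs⟩
  refine ⟨hm.isEmbedding_of_ordConnected (isPreconnected_range hc).ordConnected, ?_⟩
  rw [hr]
  exact isOpen_iUnion fun t => isOpen_Iio

/-- Among the open rays with a given origin there is a largest one. -/
theorem exists_maximal_ray {X : Type*} [MetricSpace X] [CompactSpace X]
    {φ₀ : ℝ≥0 → X} (hφ₀ : IsOpenEmbedding φ₀) :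
    ∃ Φ : ℝ≥0 → X, IsOpenEmbedding Φ ∧ Φ 0 = φ₀ 0 ∧
      ∀ ψ : ℝ≥0 → X, IsOpenEmbedding ψ → ψ 0 = φ₀ 0 → range ψ ⊆ range Φ := by
  have : Nonempty X := ⟨φ₀ 0⟩
  obtain ⟨H, H0, Hlt, Hc⟩ := exists_continuous_size (X := X)
  set p := φ₀ 0
  let S : Set X := {x | ∃ ψ : ℝ≥0 → X, ∃ t, IsOpenEmbedding ψ ∧ ψ 0 = p ∧ ψ t = x}
  have hray : ∀ x : S, ∃ ψ : ℝ≥0 → X, ∃ t, IsOpenEmbedding ψ ∧ ψ 0 = p ∧ ψ t = x := fun x => x.2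
  choose ψ τ hψ hψ0 hψτ using hray
  have memS : ∀ φ : ℝ≥0 → X, IsOpenEmbedding φ → φ 0 = p → ∀ t, φ t ∈ S :=
    fun φ h h0 t => ⟨φ, t, h, h0, rfl⟩
  let h : S → ℝ := fun x => H {p} - H (ψ x '' Iic (τ x))
  have hval : ∀ (φ : ℝ≥0 → X) (hφ : IsOpenEmbedding φ) (h0 : φ 0 = p) (t : ℝ≥0),
      h ⟨φ t, memS φ hφ h0 t⟩ = H {p} - H (φ '' Iic t) := by
    intro φ hφ h0 t
    show H {p} - _ = _
    rw [image_Iic_eq_of_ray (hψ _) hφ ((hψ0 _).trans h0.symm) (hψτ _)]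
  have hmono : ∀ (φ : ℝ≥0 → X) (hφ : IsOpenEmbedding φ) (h0 : φ 0 = p),
      StrictMono fun t => h ⟨φ t, memS φ hφ h0 t⟩ := by
    intro φ hφ h0 s t hst
    simp only [hval φ hφ h0]
    have := Hlt (φ '' Iic s) (φ '' Iic t)
      (by rw [← Set.Icc_bot]; exact (isCompact_Icc.image hφ.continuous).isClosed)
      ⟨φ s, s, self_mem_Iic, rfl⟩
      ⟨image_mono (Iic_subset_Iic.2 hst.le), fun hsub => by
        obtain ⟨r, hr, hrt⟩ := hsub ⟨t, self_mem_Iic, rfl⟩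
        exact (hφ.injective hrt ▸ hst).not_ge hr⟩
    linarith
  have hcont : ∀ (φ : ℝ≥0 → X) (hφ : IsOpenEmbedding φ) (h0 : φ 0 = p),
      Continuous fun t => h ⟨φ t, memS φ hφ h0 t⟩ := by
    intro φ hφ h0
    simp only [hval φ hφ h0]
    exact continuous_const.sub (Hc φ hφ.continuous)
  have hzero : ∀ (φ : ℝ≥0 → X) (hφ : IsOpenEmbedding φ) (h0 : φ 0 = p),
      h ⟨φ 0, memS φ hφ h0 0⟩ = 0 := by
    intro φ hφ h0
    rw [hval φ hφ h0]
    have : φ '' Iic 0 = {p} := by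
      rw [← bot_eq_zero, Iic_bot, image_singleton, bot_eq_zero, h0]
    rw [this, sub_self]
  have hbdd : BddAbove (range h) := by
    refine ⟨H {p}, ?_⟩
    rintro _ ⟨x, rfl⟩
    exact sub_le_self _ (H0 _)
  set L := sSup (range h) with hL
  have hltL : ∀ x, h x < L := by
    rintro ⟨x, φ, t, hφ, h0, rfl⟩
    exact (hmono φ hφ h0 (lt_add_one t)).trans_le (le_csSup hbdd (mem_range_self _))
  have hnonneg : ∀ x, 0 ≤ h x := by
    rintro ⟨x, φ, t, hφ, h0, rfl⟩
    rw [← hzero φ hφ h0]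
    exact (hmono φ hφ h0).monotone zero_le
  let T : S → ℝ≥0 := fun x => ⟨h x / (L - h x), div_nonneg (hnonneg x) (sub_nonneg.2 (hltL x).le)⟩
  have hTlt : ∀ x y, h x < h y → T x < T y := by
    intro x y hxy
    rw [← NNReal.coe_lt_coe]
    show h x / (L - h x) < h y / (L - h y)
    rw [div_lt_div_iff₀ (sub_pos.2 (hltL x)) (sub_pos.2 (hltL y))]
    have hLpos : 0 < L := (hnonneg x).trans_lt (hltL x)
    nlinarith
  have hTemb : ∀ (φ : ℝ≥0 → X) (hφ : IsOpenEmbedding φ) (h0 : φ 0 = p),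
      IsOpenEmbedding fun t => T ⟨φ t, memS φ hφ h0 t⟩ := by
    intro φ hφ h0
    refine StrictMono.isOpenEmbedding_nnreal (fun s t hst => hTlt _ _ (hmono φ hφ h0 hst)) ?_ ?_
    · refine Continuous.subtype_mk ?_ _
      exact (hcont φ hφ h0).div (continuous_const.sub (hcont φ hφ h0))
        fun t => (sub_pos.2 (hltL _)).ne'
    · refine NNReal.eq ?_
      show h _ / _ = 0
      rw [hzero φ hφ h0, zero_div]
  have hemb : ∀ (φ : ℝ≥0 → X) (hφ : IsOpenEmbedding φ) (h0 : φ 0 = p),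
      IsOpenEmbedding fun t => (⟨φ t, memS φ hφ h0 t⟩ : S) := by
    intro φ hφ h0
    refine .of_continuous_injective_isOpenMap (hφ.continuous.subtype_mk _) ?_ ?_
    · intro s t hst
      exact hφ.injective (congrArg Subtype.val hst)
    · intro U hU
      have := (hφ.isOpenMap U hU).preimage (continuous_subtype_val (p := (· ∈ S)))
      convert this using 1
      ext x
      constructor
      · rintro ⟨t, ht, rfl⟩
        exact ⟨t, ht, rfl⟩
      · rintro ⟨t, ht, hx⟩
        exact ⟨t, ht, Subtype.ext hx⟩
  have hTc : Continuous T := by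
    rw [continuous_iff_continuousAt]
    rintro ⟨x, φ, t, hφ, h0, rfl⟩
    exact (hemb φ hφ h0).continuousAt_iff.1 (hTemb φ hφ h0).continuous.continuousAt
  have hTo : IsOpenMap T := by
    rw [isOpenMap_iff_nhds_le]
    rintro ⟨x, φ, t, hφ, h0, rfl⟩
    rw [← (hemb φ hφ h0).map_nhds_eq t, Filter.map_map]
    exact ((hTemb φ hφ h0).map_nhds_eq t).ge
  have hTinj : Function.Injective T := by
    have aux : ∀ (φ : ℝ≥0 → X) (hφ : IsOpenEmbedding φ) (h0 : φ 0 = p) (s t : ℝ≥0),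
      T ⟨φ s, memS φ hφ h0 s⟩ = T ⟨φ t, memS φ hφ h0 t⟩ → φ s = φ t :=
      fun φ hφ h0 s t h => by rw [(hTemb φ hφ h0).injective h]
    rintro ⟨x, φ, s, hφ, h0, rfl⟩ ⟨y, φ', t, hφ', h0', rfl⟩ heq
    apply Subtype.ext
    rcases mem_image_Iic_or_of_ray hφ hφ' (h0.trans h0'.symm) s t with ⟨r, -, hr⟩ | ⟨r, -, hr⟩
    · simp only [← hr] at heq ⊢
      exact aux φ' hφ' h0' _ _ heq
    · simp only [← hr] at heq ⊢
      exact aux φ hφ h0 _ _ heq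
  have hTsurj : Function.Surjective T := by
    intro w
    have hw : 0 ≤ (w : ℝ) := w.2
    have hLpos : 0 < L := (hnonneg ⟨p, memS φ₀ hφ₀ rfl 0⟩).trans_lt (hltL _)
    have hv : w * L / (1 + w) < L := by
      rw [div_lt_iff₀ (by positivity)]
      nlinarith
    obtain ⟨_, ⟨⟨x, φ, t, hφ, h0, rfl⟩, rfl⟩, hlt⟩ :=
      exists_lt_of_lt_csSup ⟨_, mem_range_self (⟨p, memS φ₀ hφ₀ rfl 0⟩ : S)⟩ hv
    obtain ⟨s, -, hs⟩ := intermediate_value_Icc (zero_le : 0 ≤ t) (hcont φ hφ h0).continuousOn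
      ⟨by rw [hzero φ hφ h0]; positivity, hlt.le⟩
    refine ⟨⟨φ s, memS φ hφ h0 s⟩, NNReal.eq ?_⟩
    show h _ / (L - h _) = w
    simp only at hs
    rw [hs]
    field_simp
    ring
  have hSopen : IsOpen S := by
    rw [isOpen_iff_mem_nhds]
    rintro _ ⟨φ, t, hφ, h0, rfl⟩
    refine Filter.mem_of_superset (hφ.isOpen_range.mem_nhds (mem_range_self t)) ?_
    rintro _ ⟨s, rfl⟩
    exact memS φ hφ h0 s
  let e : S ≃ₜ ℝ≥0 := (Equiv.ofBijective T ⟨hTinj, hTsurj⟩).toHomeomorphOfContinuousOpen hTc hTo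
  refine ⟨fun w => e.symm w, hSopen.isOpenEmbedding_subtypeVal.comp e.symm.isOpenEmbedding, ?_, ?_⟩
  · have : e ⟨p, memS φ₀ hφ₀ rfl 0⟩ = 0 := by
      refine NNReal.eq ?_
      show h _ / _ = 0
      rw [hzero φ₀ hφ₀ rfl, zero_div]
    simp only [← this, e.symm_apply_apply]
  · rintro φ hφ h0 _ ⟨t, rfl⟩
    exact ⟨e ⟨φ t, memS φ hφ h0 t⟩, by simp only [e.symm_apply_apply]⟩

theorem isOpenEmbedding_toNNReal_exp : IsOpenEmbedding fun x : ℝ => (Real.exp x).toNNReal := by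
  have hm : StrictMono fun x : ℝ => (Real.exp x).toNNReal := fun x y h =>
    (Real.toNNReal_lt_toNNReal_iff (Real.exp_pos y)).2 (Real.exp_lt_exp.2 h)
  have hc : Continuous fun x : ℝ => (Real.exp x).toNNReal := by fun_prop
  refine ⟨hm.isEmbedding_of_ordConnected (isPreconnected_range hc).ordConnected, ?_⟩
  have : range (fun x : ℝ => (Real.exp x).toNNReal) = Ioi 0 := by
    ext t
    constructor
    · rintro ⟨x, rfl⟩
      exact Real.toNNReal_pos.2 (Real.exp_pos x)
    · intro ht
      exact ⟨Real.log t, by simp [Real.exp_log (NNReal.coe_pos.2 ht)]⟩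
  rw [this]
  exact isOpen_Ioi

theorem exists_toNNReal_exp_eq {t : ℝ≥0} (ht : t ≠ 0) : ∃ x : ℝ, (Real.exp x).toNNReal = t :=
  ⟨Real.log t, by simp [Real.exp_log (NNReal.coe_pos.2 (pos_iff_ne_zero.2 ht))]⟩

theorem exists_ray_range_superset_of_strictMono {X : Type*} [TopologicalSpace X] [T2Space X]
    {Φ : ℝ≥0 → X} (hΦ : IsOpenEmbedding Φ) {e : ℝ → X} (he : IsOpenEmbedding e)
    (h0 : Φ 0 ∉ range e) {q : ℝ → ℝ} (hq : ∀ x, e (q x) = Φ (Real.exp x).toNNReal)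
    (hqc : Continuous q) (hqm : StrictMono q) :
    ∃ Ψ : ℝ≥0 → X, IsOpenEmbedding Ψ ∧ Ψ 0 = Φ 0 ∧ range e ⊆ range Ψ := by
  have hE := isOpenEmbedding_toNNReal_exp
  set E : ℝ → ℝ≥0 := fun x => (Real.exp x).toNNReal with hEdef
  have hEpos : ∀ x, 0 < E x := fun x => Real.toNNReal_pos.2 (Real.exp_pos x)
  have hEm : StrictMono E := fun x y h =>
    (Real.toNNReal_lt_toNNReal_iff (Real.exp_pos y)).2 (Real.exp_lt_exp.2 h)
  have hE0 : Filter.Tendsto E Filter.atBot (𝓝 0) := by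
    have := (continuous_real_toNNReal.tendsto 0).comp Real.tendsto_exp_atBot
    rwa [Real.toNNReal_zero] at this
  have hqbot : Filter.Tendsto q Filter.atBot Filter.atBot := by
    rcases tendsto_atBot_of_monotone hqm.monotone with h | ⟨l, hl⟩
    · exact h
    · exfalso
      have h1 : Filter.Tendsto (fun x => e (q x)) Filter.atBot (𝓝 (e l)) :=
        (he.continuous.tendsto l).comp hl
      have h2 : Filter.Tendsto (fun x => e (q x)) Filter.atBot (𝓝 (Φ 0)) := by
        simp only [hq]
        exact (hΦ.continuous.tendsto 0).comp hE0
      exact h0 ⟨l, tendsto_nhds_unique h1 h2⟩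
  have hcov : ∀ x y, y < q x → ∃ z, z < x ∧ e y = Φ (E z) := by
    intro x y hy
    obtain ⟨w, hw, hwx⟩ := ((hqbot.eventually_lt_atBot y).and (Filter.eventually_lt_atBot x)).exists
    obtain ⟨z, hz, rfl⟩ := intermediate_value_Icc hwx.le hqc.continuousOn ⟨hw.le, hy.le⟩
    exact ⟨z, hqm.lt_iff_lt.1 hy, hq z⟩
  let Ψ : ℝ≥0 → X := fun t => if t = 0 then Φ 0 else e (Real.log t)
  have hΨ0 : Ψ 0 = Φ 0 := if_pos rfl
  have hΨE : ∀ x, Ψ (E x) = e x := by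
    intro x
    simp only [Ψ, if_neg (hEpos x).ne']
    simp [hEdef, Real.toNNReal_of_nonneg (Real.exp_pos x).le]
  have hcases : ∀ t : ℝ≥0, t = 0 ∨ ∃ x, t = E x := fun t => by
    by_cases ht : t = 0
    · exact Or.inl ht
    · exact Or.inr ((exists_toNNReal_exp_eq ht).imp fun _ h => h.symm)
  have hcomp : Ψ ∘ E = e := funext hΨE
  have hnb : ∀ s ∈ 𝓝 (0 : ℝ≥0), ∃ x, ∀ t < E x, t ∈ s := by
    intro s hs
    obtain ⟨δ, hδ, hsub⟩ := exists_Ico_subset_of_mem_nhds hs ⟨1, zero_lt_one⟩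
    obtain ⟨x, rfl⟩ := (hcases δ).resolve_left hδ.ne'
    exact ⟨x, fun t ht => hsub ⟨zero_le, ht⟩⟩
  refine ⟨Ψ, .of_continuous_injective_isOpenMap ?_ ?_ ?_, hΨ0, ?_⟩
  · rw [continuous_iff_continuousAt]
    intro t
    rcases hcases t with rfl | ⟨x, rfl⟩
    · intro U hU
      rw [hΨ0] at hU
      obtain ⟨x, hx⟩ := hnb _ (hΦ.continuous.continuousAt hU)
      refine Filter.mem_map.2
        (Filter.mem_of_superset (Iio_mem_nhds (hEpos (q x))) fun t ht => ?_)
      rcases hcases t with rfl | ⟨y, rfl⟩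
      · rw [mem_preimage, hΨ0]
        exact mem_of_mem_nhds hU
      · obtain ⟨z, hz, hyz⟩ := hcov x y (hEm.lt_iff_lt.1 ht)
        rw [mem_preimage, hΨE, hyz]
        exact hx _ (hEm hz)
    · rw [← hE.continuousAt_iff, hcomp]
      exact he.continuous.continuousAt
  · intro s t hst
    rcases hcases s with rfl | ⟨x, rfl⟩ <;> rcases hcases t with rfl | ⟨y, rfl⟩
    · rfl
    · rw [hΨ0, hΨE] at hst
      exact (h0 ⟨y, hst.symm⟩).elim
    · rw [hΨ0, hΨE] at hst
      exact (h0 ⟨x, hst⟩).elim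
    · rw [hΨE, hΨE] at hst
      rw [he.injective hst]
  · rw [isOpenMap_iff_nhds_le]
    intro t
    rcases hcases t with rfl | ⟨x, rfl⟩
    · intro s hs
      rw [hΨ0]
      obtain ⟨x, hx⟩ := hnb _ (Filter.mem_map.1 hs)
      obtain ⟨y, hy⟩ := (hqbot.eventually_lt_atBot x).exists
      refine Filter.mem_of_superset
        ((hΦ.isOpenMap _ isOpen_Iio).mem_nhds ⟨0, hEpos y, rfl⟩) ?_
      rintro _ ⟨r, hr, rfl⟩
      rcases hcases r with rfl | ⟨z, rfl⟩
      · rw [← hΨ0]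
        exact hx 0 (hEpos x)
      · rw [← hq, ← hΨE]
        exact hx _ (hEm ((hqm (hEm.lt_iff_lt.1 hr)).trans hy))
    · rw [hE.map_nhds_eq x |>.symm, Filter.map_map, hcomp, hΨE]
      exact (he.map_nhds_eq x).ge
  · rintro _ ⟨x, rfl⟩
    exact ⟨E x, hΨE x⟩

/-- An open interval containing an open ray minus its origin `p`, but not `p`, is covered by an
open ray from `p`. -/
theorem exists_ray_range_superset {X : Type*} [TopologicalSpace X] [T2Space X]
    {Φ : ℝ≥0 → X} (hΦ : IsOpenEmbedding Φ) {e : ℝ → X} (he : IsOpenEmbedding e)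
    (h0 : Φ 0 ∉ range e) (hsub : Φ '' Ioi 0 ⊆ range e) :
    ∃ Ψ : ℝ≥0 → X, IsOpenEmbedding Ψ ∧ Ψ 0 = Φ 0 ∧ range e ⊆ range Ψ := by
  have hE := isOpenEmbedding_toNNReal_exp
  have : ∀ x : ℝ, ∃ y, e y = Φ (Real.exp x).toNNReal := fun x =>
    hsub ⟨_, Real.toNNReal_pos.2 (Real.exp_pos x), rfl⟩
  choose q hq using this
  have hcomp : e ∘ q = Φ ∘ fun x => (Real.exp x).toNNReal := funext hq
  have hqc : Continuous q := by
    rw [he.isEmbedding.continuous_iff, hcomp]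
    exact hΦ.continuous.comp hE.continuous
  have hqi : Function.Injective q := by
    apply Function.Injective.of_comp (f := e)
    rw [hcomp]
    exact hΦ.injective.comp hE.injective
  rcases hqc.strictMono_of_inj hqi with h | h
  · exact exists_ray_range_superset_of_strictMono hΦ he h0 hq hqc h
  · have hr : range (e ∘ Homeomorph.neg ℝ) = range e :=
      (Homeomorph.neg ℝ).surjective.range_comp e
    rw [← hr] at h0 ⊢
    exact exists_ray_range_superset_of_strictMono (q := fun x => - q x) hΦ
      (he.comp (Homeomorph.neg ℝ).isOpenEmbedding) h0 (by simpa using hq) hqc.neg h.neg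

/-- In a compact locally connected space every open ray converges. -/
theorem exists_tendsto_of_ray {X : Type*} [TopologicalSpace X] [T2Space X] [CompactSpace X]
    [LocallyConnectedSpace X] {Φ : ℝ≥0 → X} (hΦ : IsOpenEmbedding Φ) :
    ∃ b, b ∉ range Φ ∧ Filter.Tendsto Φ Filter.atTop (𝓝 b) := by
  obtain ⟨b, hb⟩ := exists_clusterPt_of_compactSpace (Filter.map Φ Filter.atTop)
  have hfreq : ∀ s ∈ 𝓝 b, ∃ᶠ t in Filter.atTop, Φ t ∈ s := fun s hs =>
    MapClusterPt.frequently hb hs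
  have hbr : b ∉ range Φ := by
    rintro ⟨r, rfl⟩
    obtain ⟨s, ⟨u, hu, hus⟩, hs⟩ := ((hfreq _ ((hΦ.isOpenMap _ isOpen_Iio).mem_nhds
      ⟨r, lt_add_one r, rfl⟩)).and_eventually (Filter.eventually_ge_atTop (r + 1))).exists
    exact (hΦ.injective hus ▸ hs).not_gt hu
  refine ⟨b, hbr, fun U hU => ?_⟩
  obtain ⟨C, ⟨hCo, hbC, hC⟩, hCU⟩ :=
    (LocallyConnectedSpace.open_connected_basis b).mem_iff.1 hU
  obtain ⟨s, hs⟩ := (hfreq C (hCo.mem_nhds hbC)).exists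
  refine Filter.mem_map.2 ?_
  filter_upwards [Filter.eventually_gt_atTop s] with t ht
  exact hCU (hC.isPreconnected.apply_mem_of_ray hΦ hs ⟨s, ht, rfl⟩ hbC
    fun ⟨r, _, hr⟩ => hbr ⟨r, hr⟩)

theorem nonempty_homeomorph_image {X : Type*} [TopologicalSpace X] {Φ : ℝ≥0 → X}
    (hΦ : IsEmbedding Φ) {I : Set ℝ} [I.OrdConnected] {m : ℝ → ℝ≥0} (hm : StrictMonoOn m I)
    (hc : ContinuousOn m I) : Nonempty (Φ '' (m '' I) ≃ₜ I) := by
  have h1 : IsEmbedding fun x : I => m x := by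
    have hr : range (fun x : I => m x) = m '' I := by
      rw [image_eq_range]
    refine StrictMono.isEmbedding_of_ordConnected (fun x y h => hm x.2 y.2 h) ?_
    rw [hr]
    exact ((isPreconnected_iff_ordConnected.2 ‹_›).image m hc).ordConnected
  have h2 := hΦ.comp h1
  refine ⟨(h2.toHomeomorph.trans (Homeomorph.setCongr ?_)).symm⟩
  rw [range_comp, ← image_eq_range]

theorem strictMonoOn_toNNReal_div_one_sub :
    StrictMonoOn (fun x : ℝ => (x / (1 - x)).toNNReal) (Ico 0 1) := by
  intro x hx y hy h
  refine (Real.toNNReal_lt_toNNReal_iff (div_pos (hx.1.trans_lt h) (sub_pos.2 hy.2))).2 ?_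
  rw [div_lt_div_iff₀ (sub_pos.2 hx.2) (sub_pos.2 hy.2)]
  nlinarith

theorem continuousAt_toNNReal_div_one_sub {x : ℝ} (hx : x ≠ 1) :
    ContinuousAt (fun x : ℝ => (x / (1 - x)).toNNReal) x :=
  continuous_real_toNNReal.continuousAt.comp
    (continuousAt_id.div (continuousAt_const.sub continuousAt_id) (sub_ne_zero.2 hx.symm))

theorem exists_mem_Ico_toNNReal_div_one_sub_eq (t : ℝ≥0) :
    ∃ x ∈ Ico (0 : ℝ) 1, (x / (1 - x)).toNNReal = t := by
  have ht : (0 : ℝ) ≤ t := t.2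
  refine ⟨t / (1 + t), ⟨by positivity, ?_⟩, ?_⟩
  · rw [div_lt_one (by positivity)]
    linarith
  · have : (t / (1 + t) / (1 - t / (1 + t)) : ℝ) = t := by
      field_simp
      ring
    rw [this, Real.toNNReal_coe]

theorem tendsto_toNNReal_div_one_sub :
    Filter.Tendsto (fun x : ℝ => (x / (1 - x)).toNNReal) (𝓝[<] 1) Filter.atTop := by
  refine Real.tendsto_toNNReal_atTop_iff.2 ?_
  simp only [div_eq_mul_inv]
  refine Filter.Tendsto.pos_mul_atTop zero_lt_one (Filter.tendsto_id.mono_left nhdsWithin_le_nhds) ?_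
  refine tendsto_inv_nhdsGT_zero.comp (tendsto_nhdsWithin_iff.2 ⟨?_, ?_⟩)
  · have : Filter.Tendsto (fun x : ℝ => 1 - x) (𝓝 1) (𝓝 (1 - 1)) :=
      (continuous_const.sub continuous_id).tendsto 1
    rw [sub_self] at this
    exact this.mono_left nhdsWithin_le_nhds
  · filter_upwards [self_mem_nhdsWithin] with x hx
    exact sub_pos.2 (mem_Iio.1 hx)

theorem isEndpointOf_ray_zero {X : Type*} [TopologicalSpace X] [T2Space X]
    {Φ : ℝ≥0 → X} (hΦ : IsOpenEmbedding Φ) : IsEndpointOf X (Φ 0) := by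
  intro U hU h0
  obtain ⟨ε, hε, hsub⟩ := exists_Ico_subset_of_mem_nhds
    ((hU.preimage hΦ.continuous).mem_nhds h0) ⟨1, zero_lt_one⟩
  refine ⟨Φ '' Iio ε, hΦ.isOpenMap _ isOpen_Iio, ⟨0, hε, rfl⟩, ?_, Φ ε, ?_⟩
  · rintro _ ⟨r, hr, rfl⟩
    exact hsub ⟨zero_le, hr⟩
  · have hcl : closure (Φ '' Iio ε) = Φ '' Iic ε := by
      apply Subset.antisymm
      · refine closure_minimal (image_mono Iio_subset_Iic_self) ?_
        rw [← Set.Icc_bot]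
        exact (isCompact_Icc.image hΦ.continuous).isClosed
      · rw [← closure_Iio' (a := ε) ⟨0, hε⟩]
        exact image_closure_subset_closure_image hΦ.continuous
    rw [(hΦ.isOpenMap _ isOpen_Iio).frontier_eq, hcl, ← image_sdiff hΦ.injective, ← image_singleton]
    congr 1
    ext r
    simp only [mem_sdiff, mem_Iic, mem_Iio, not_lt, mem_singleton_iff]
    exact ⟨fun h => h.1.antisymm h.2, fun h => h ▸ ⟨le_rfl, le_rfl⟩⟩

/-- All open rays from a common origin lie, apart from the origin, in one maximal free open
interval of Type I. -/
theorem exists_isTypeI_of_ray {X : Type*} [MetricSpace X] [CompactSpace X]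
    [LocallyConnectedSpace X] {φ₀ : ℝ≥0 → X} (hφ₀ : IsOpenEmbedding φ₀) :
    ∃ J : Set X, IsTypeI J ∧
      ∀ ψ : ℝ≥0 → X, IsOpenEmbedding ψ → ψ 0 = φ₀ 0 → ψ '' Ioi 0 ⊆ J := by
  obtain ⟨Φ, hΦ, hΦ0, hmax⟩ := exists_maximal_ray hφ₀
  rw [← hΦ0] at hmax ⊢
  obtain ⟨b, hb, hlim⟩ := exists_tendsto_of_ray hΦ
  have hrange : range Φ = insert (Φ 0) (Φ '' Ioi 0) := by
    rw [← image_univ, ← image_insert_eq, Ioi_insert, ← bot_eq_zero, Ici_bot]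
  have hJ : ∀ ψ : ℝ≥0 → X, IsOpenEmbedding ψ → ψ 0 = Φ 0 → ψ '' Ioi 0 ⊆ Φ '' Ioi 0 := by
    rintro ψ hψ h0 _ ⟨t, ht, rfl⟩
    have := hmax ψ hψ h0 (mem_range_self t)
    rw [hrange] at this
    refine this.resolve_left fun h => ?_
    rw [← h0] at h
    exact (show 0 < t from ht).ne' (hψ.injective h)
  have h0J : Φ 0 ∉ Φ '' Ioi 0 := by
    rintro ⟨t, ht, h⟩
    exact (show 0 < t from ht).ne' (hΦ.injective h)
  let γ : ℝ → X := fun x => if x < 1 then Φ (x / (1 - x)).toNNReal else b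
  have hγlt : ∀ x < 1, γ x = Φ (x / (1 - x)).toNNReal := fun x hx => if_pos hx
  have hγ1 : γ 1 = b := if_neg (lt_irrefl _)
  have hγc : ContinuousOn γ (Icc 0 1) := by
    intro x hx
    rcases hx.2.lt_or_eq with h | rfl
    · refine ContinuousAt.continuousWithinAt ?_
      have h1 : ContinuousAt (fun x : ℝ => Φ (x / (1 - x)).toNNReal) x :=
        hΦ.continuous.continuousAt.comp (continuousAt_toNNReal_div_one_sub h.ne)
      refine h1.congr ?_
      filter_upwards [Iio_mem_nhds h] with y hy
      exact (hγlt y hy).symm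
    · refine ContinuousWithinAt.mono (t := insert 1 (Iio 1)) ?_ fun y hy => ?_
      · rw [continuousWithinAt_insert_self, ContinuousWithinAt, hγ1]
        refine (hlim.comp tendsto_toNNReal_div_one_sub).congr' ?_
        filter_upwards [self_mem_nhdsWithin] with y hy
        exact (hγlt y hy).symm
      · rw [Iio_insert]
        exact hy.2
  have hγi : InjOn γ (Icc 0 1) := by
    intro x hx y hy h
    rcases hx.2.lt_or_eq with h1 | rfl <;> rcases hy.2.lt_or_eq with h2 | rfl
    · rw [hγlt x h1, hγlt y h2] at h
      exact strictMonoOn_toNNReal_div_one_sub.injOn ⟨hx.1, h1⟩ ⟨hy.1, h2⟩ (hΦ.injective h)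
    · rw [hγlt x h1, hγ1] at h
      exact (hb ⟨_, h⟩).elim
    · rw [hγlt y h2, hγ1] at h
      exact (hb ⟨_, h.symm⟩).elim
    · rfl
  have hγim : γ '' Icc 0 1 = insert b (range Φ) := by
    apply Subset.antisymm
    · rintro _ ⟨x, hx, rfl⟩
      rcases hx.2.lt_or_eq with h | rfl
      · rw [hγlt x h]
        exact Or.inr ⟨_, rfl⟩
      · exact Or.inl hγ1
    · rintro _ (rfl | ⟨t, rfl⟩)
      · exact ⟨1, ⟨zero_le_one, le_rfl⟩, hγ1⟩
      · obtain ⟨x, hx, rfl⟩ := exists_mem_Ico_toNNReal_div_one_sub_eq t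
        exact ⟨x, ⟨hx.1, hx.2.le⟩, hγlt x hx.2⟩
  have hcl : closure (Φ '' Ioi 0) = insert b (range Φ) := by
    apply Subset.antisymm
    · refine closure_minimal ((image_subset_range _ _).trans (subset_insert _ _)) ?_
      rw [← hγim]
      exact (isCompact_Icc.image_of_continuousOn hγc).isClosed
    · rintro x (rfl | ⟨t, rfl⟩)
      · refine mem_closure_of_tendsto hlim ?_
        filter_upwards [Filter.eventually_gt_atTop 0] with t ht
        exact ⟨t, ht, rfl⟩
      · refine image_closure_subset_closure_image hΦ.continuous ⟨t, ?_, rfl⟩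
        rw [closure_Ioi]
        exact mem_Ici.2 zero_le
  have him : (fun x : ℝ => (x / (1 - x)).toNNReal) '' Ioo 0 1 = Ioi 0 := by
    ext t
    constructor
    · rintro ⟨x, hx, rfl⟩
      exact Real.toNNReal_pos.2 (div_pos hx.1 (sub_pos.2 hx.2))
    · intro ht
      obtain ⟨x, hx, rfl⟩ := exists_mem_Ico_toNNReal_div_one_sub_eq t
      refine ⟨x, ⟨hx.1.lt_of_ne ?_, hx.2⟩, rfl⟩
      rintro rfl
      simp at ht
  have hfree : IsFreeOpenInterval (Φ '' Ioi 0) := by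
    refine ⟨hΦ.isOpenMap _ isOpen_Ioi, ?_⟩
    have := nonempty_homeomorph_image hΦ.isEmbedding (I := Ioo 0 1)
      (strictMonoOn_toNNReal_div_one_sub.mono Ioo_subset_Ico_self)
      (fun x hx => (continuousAt_toNNReal_div_one_sub hx.2.ne).continuousWithinAt)
    rwa [him] at this
  refine ⟨Φ '' Ioi 0, ⟨⟨hfree, ?_⟩, Φ 0, b, ?_, h0J, ?_, ?_, ?_, ?_⟩, hJ⟩
  · rintro K ⟨hK, ⟨κ⟩⟩ hJK
    refine hJK.antisymm ?_
    have hsig : IsEmbedding Real.sigmoid :=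
      Real.sigmoid_strictMono.isEmbedding_of_ordConnected
        (by rw [Real.range_sigmoid]; exact ordConnected_Ioo)
    let σ : ℝ ≃ₜ Ioo (0 : ℝ) 1 :=
      hsig.toHomeomorph.trans (Homeomorph.setCongr Real.range_sigmoid)
    have he : IsOpenEmbedding fun x => (κ.symm (σ x) : X) :=
      hK.isOpenEmbedding_subtypeVal.comp (σ.trans κ.symm).isOpenEmbedding
    have hr : range (fun x => (κ.symm (σ x) : X)) = K := by
      have := (σ.trans κ.symm).surjective.range_comp (Subtype.val : K → X)
      rw [Subtype.range_coe] at this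
      exact this
    have h0 : Φ 0 ∉ range (fun x => (κ.symm (σ x) : X)) := ray_zero_notMem_range hΦ he
    obtain ⟨Ψ, hΨ, hΨ0, hsub⟩ := exists_ray_range_superset hΦ he h0 (by rwa [hr])
    rw [hr] at h0 hsub
    intro x hx
    have := hmax Ψ hΨ hΨ0 (hsub hx)
    rw [hrange] at this
    exact this.resolve_left fun h => h0 (h ▸ hx)
  · rintro rfl
    exact hb ⟨0, rfl⟩
  · exact fun h => hb (image_subset_range _ _ h)
  · rw [hcl, hrange]
    ext x
    simp only [mem_insert_iff, mem_union, mem_singleton_iff]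
    tauto
  · refine ⟨γ, hγc, hγi, hγim.trans hcl.symm, ?_, hγ1⟩
    rw [hγlt 0 zero_lt_one]
    simp
  · exact Or.inl (isEndpointOf_ray_zero hΦ)

theorem IsArcEnds.symm {X : Type*} [TopologicalSpace X] {A : Set X} {a b : X}
    (h : IsArcEnds A a b) : IsArcEnds A b a := by
  obtain ⟨γ, hc, hi, him, h0, h1⟩ := h
  have hmaps : MapsTo (fun x : ℝ => 1 - x) (Icc 0 1) (Icc 0 1) := fun x hx =>
    ⟨sub_nonneg.2 hx.2, sub_le_self _ hx.1⟩
  refine ⟨fun x => γ (1 - x), hc.comp (by fun_prop) hmaps, fun x hx y hy hxy => ?_, ?_, ?_, ?_⟩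
  · exact sub_right_injective (hi (hmaps hx) (hmaps hy) hxy)
  · rw [← him]
    apply Subset.antisymm
    · rintro _ ⟨x, hx, rfl⟩
      exact ⟨_, hmaps hx, rfl⟩
    · rintro _ ⟨x, hx, rfl⟩
      exact ⟨1 - x, hmaps hx, by simp⟩
  · simpa using h1
  · simpa using h0

/-- If the closure of an open arc has an endpoint of a connected space among its two ends,
then adding that end keeps the arc open. -/
theorem isOpen_insert_of_isEndpointOf {X : Type*} [TopologicalSpace X] [T2Space X]
    [ConnectedSpace X] {J : Set X} {a b : X} (hJ : IsOpen J) (hab : a ≠ b) (ha : a ∉ J)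
    (hcl : closure J = J ∪ {a, b}) (hconn : IsPreconnected (closure J))
    (hend : IsEndpointOf X a) : IsOpen (insert a J) := by
  have key : ∀ U : Set X, IsOpen U → a ∈ U → ∃ V, IsOpen V ∧ a ∈ V ∧ V ⊆ U ∧ b ∉ closure V ∧
      ∀ x ∈ closure V, x ∉ J → x ∈ V := by
    intro U hU haU
    obtain ⟨U₁, U₂, hU₁, hU₂, ha₁, hb₂, hdisj⟩ := t2_separation hab
    obtain ⟨V, hV, haV, hVU, y, hy⟩ := hend (U ∩ U₁) (hU.inter hU₁) ⟨haU, ha₁⟩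
    have hbV : b ∉ closure V := fun h =>
      (closure_minimal (fun x hx hx2 => hdisj.le_bot ⟨(hVU hx).2, hx2⟩) hU₂.isClosed_compl h) hb₂
    refine ⟨V, hV, haV, hVU.trans inter_subset_left, hbV, fun x hx hxJ => ?_⟩
    have hyV : y ∈ closure V ∧ y ∉ V := by
      have : y ∈ frontier V := by rw [hy]; rfl
      rwa [hV.frontier_eq] at this
    have hyJ : y ∈ J := by
      obtain ⟨z, hz, hzf⟩ : (closure J ∩ frontier V).Nonempty := by
        by_contra hne
        rw [not_nonempty_iff_eq_empty] at hne
        obtain ⟨w, -, hw1, hw2⟩ := hconn V (closure V)ᶜ hV isClosed_closure.isOpen_compl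
          (fun w hw => by
            by_cases h : w ∈ closure V
            · refine Or.inl ?_
              by_contra hwV
              have : w ∈ closure J ∩ frontier V := ⟨hw, by rw [hV.frontier_eq]; exact ⟨h, hwV⟩⟩
              rw [hne] at this
              exact this
            · exact Or.inr h)
          ⟨a, by rw [hcl]; simp, haV⟩ ⟨b, by rw [hcl]; simp, hbV⟩
        exact hw2 (subset_closure hw1)
      rw [hy, mem_singleton_iff] at hzf
      subst hzf
      rw [hcl] at hz
      rcases hz with h | h | h
      · exact h
      · exact (hyV.2 (h ▸ haV)).elim
      · exact (hbV (h ▸ hyV.1)).elim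
    by_contra hxV
    have : x ∈ frontier V := by rw [hV.frontier_eq]; exact ⟨hx, hxV⟩
    rw [hy, mem_singleton_iff] at this
    exact hxJ (this ▸ hyJ)
  obtain ⟨V, hV, haV, -, hbV, hVJ⟩ := key univ isOpen_univ trivial
  have hVsub : V ⊆ insert a J := by
    intro x hx
    by_contra hxa
    rw [mem_insert_iff, not_or] at hxa
    obtain ⟨V', hV', haV', hsub, -, hVJ'⟩ := key {x}ᶜ isOpen_compl_singleton (Ne.symm hxa.1)
    have hK : IsClopen (closure V ∩ (V'ᶜ ∩ Jᶜ)) := by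
      refine ⟨isClosed_closure.inter (hV'.isClosed_compl.inter hJ.isClosed_compl), ?_⟩
      have : closure V ∩ (V'ᶜ ∩ Jᶜ) = V ∩ ((closure V')ᶜ ∩ (closure J)ᶜ) := by
        ext z
        constructor
        · rintro ⟨h1, h2, h3⟩
          refine ⟨hVJ z h1 h3, fun h => h2 (hVJ' z h h3), fun h => ?_⟩
          rw [hcl] at h
          rcases h with h | h | h
          · exact h3 h
          · exact h2 (h ▸ haV')
          · exact hbV (h ▸ h1)
        · rintro ⟨h1, h2, h3⟩
          exact ⟨subset_closure h1, fun h => h2 (subset_closure h), fun h => h3 (subset_closure h)⟩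
      rw [this]
      exact hV.inter (isClosed_closure.isOpen_compl.inter isClosed_closure.isOpen_compl)
    have huniv := hK.eq_univ ⟨x, subset_closure hx, fun h => hsub h rfl, hxa.2⟩
    have : a ∈ closure V ∩ (V'ᶜ ∩ Jᶜ) := by rw [huniv]; trivial
    exact this.2.1 haV'
  have : insert a J = V ∪ J := by
    apply Subset.antisymm
    · rintro x (rfl | h)
      · exact Or.inl haV
      · exact Or.inr h
    · exact union_subset hVsub (subset_insert _ _)
  rw [this]
  exact hV.union hJ

theorem exists_ray_of_isEndpointOf {X : Type*} [TopologicalSpace X] [T2Space X]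
    [ConnectedSpace X] {J : Set X} {a b : X} (hJ : IsOpen J) (hab : a ≠ b) (ha : a ∉ J)
    (hb : b ∉ J) (hcl : closure J = J ∪ {a, b}) (harc : IsArcEnds (closure J) a b)
    (hend : IsEndpointOf X a) : ∃ φ : ℝ≥0 → X, IsOpenEmbedding φ := by
  obtain ⟨γ, hc, hi, him, h0, h1⟩ := harc
  have hopen : IsOpen (insert a J) := by
    refine isOpen_insert_of_isEndpointOf hJ hab ha hcl ?_ hend
    rw [← him]
    exact isPreconnected_Icc.image γ hc
  have hγ : IsEmbedding ((Icc (0 : ℝ) 1).domRestrict γ) :=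
    (hc.domRestrict.isClosedEmbedding (injOn_iff_injective.1 hi)).isEmbedding
  let ι : ℝ≥0 → Icc (0 : ℝ) 1 := fun t =>
    ⟨t / (1 + t), by positivity, div_le_one_of_le₀ (by linarith) (by positivity)⟩
  have hι : IsEmbedding ι := by
    have hm : StrictMono ι := by
      intro s t hst
      show (s : ℝ) / (1 + s) < t / (1 + t)
      rw [div_lt_div_iff₀ (by positivity) (by positivity)]
      have : (s : ℝ) < t := hst
      linarith
    have hc : Continuous ι := by
      refine Continuous.subtype_mk ?_ _
      exact NNReal.continuous_coe.div (continuous_const.add NNReal.continuous_coe)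
        fun t => by positivity
    exact hm.isEmbedding_of_ordConnected (isPreconnected_range hc).ordConnected
  refine ⟨_, hγ.comp hι, ?_⟩
  convert hopen using 1
  apply Subset.antisymm
  · rintro _ ⟨t, rfl⟩
    have hmem : γ (ι t) ∈ closure J := by rw [← him]; exact ⟨_, (ι t).2, rfl⟩
    rw [hcl] at hmem
    rcases hmem with h | h | h
    · exact Or.inr h
    · exact Or.inl h
    · exfalso
      have h : γ (ι t) = b := h
      rw [← h1] at h
      have h2 : (t : ℝ) / (1 + t) = 1 := hi (ι t).2 ⟨zero_le_one, le_rfl⟩ h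
      rw [div_eq_one_iff_eq (by positivity)] at h2
      linarith
  · intro x hx
    have hxcl : x ∈ γ '' Icc 0 1 := by
      rw [him, hcl]
      rcases hx with h | h
      · exact Or.inr (Or.inl h)
      · exact Or.inl h
    obtain ⟨r, hr, rfl⟩ := hxcl
    have hr1 : r < 1 := by
      refine hr.2.lt_of_ne ?_
      rintro rfl
      rw [h1] at hx
      exact hx.elim (fun h => hab h.symm) hb
    refine ⟨⟨r / (1 - r), div_nonneg hr.1 (sub_nonneg.2 hr.2)⟩, ?_⟩
    show γ (r / (1 - r) / (1 + r / (1 - r))) = γ r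
    have : 1 - r ≠ 0 := (sub_pos.2 hr1).ne'
    congr 1
    field_simp
    ring

/-- A closed segment in the interior of an open ray is a free arc. -/
theorem isFreeArc_image_Icc {X : Type*} [TopologicalSpace X] [T2Space X]
    {φ : ℝ≥0 → X} (hφ : IsOpenEmbedding φ) {s t : ℝ≥0} (hst : s < t) :
    IsFreeArc (φ '' Icc s t) := by
  let m : ℝ → ℝ≥0 := fun x => s + x.toNNReal * (t - s)
  have hpos : 0 < t - s := tsub_pos_of_lt hst
  have hm : StrictMonoOn m (Icc 0 1) := by
    intro x hx y hy h
    have : x.toNNReal < y.toNNReal := (Real.toNNReal_lt_toNNReal_iff (hx.1.trans_lt h)).2 h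
    show s + _ < s + _
    gcongr
  have hc : Continuous m := by fun_prop
  have hm0 : m 0 = s := by simp [m]
  have hm1 : m 1 = t := by simp [m, hst.le]
  have hIoo : m '' Ioo 0 1 = Ioo s t := by
    apply Subset.antisymm
    · rintro _ ⟨x, hx, rfl⟩
      rw [← hm0, ← hm1]
      exact ⟨hm ⟨le_rfl, zero_le_one⟩ (Ioo_subset_Icc_self hx) hx.1,
        hm (Ioo_subset_Icc_self hx) ⟨zero_le_one, le_rfl⟩ hx.2⟩
    · have := intermediate_value_Ioo zero_le_one hc.continuousOn
      rwa [hm0, hm1] at this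
  have hIcc : m '' Icc 0 1 = Icc s t := by
    apply Subset.antisymm
    · rintro _ ⟨x, hx, rfl⟩
      rw [← hm0, ← hm1]
      exact ⟨hm.monotoneOn ⟨le_rfl, zero_le_one⟩ hx hx.1,
        hm.monotoneOn hx ⟨zero_le_one, le_rfl⟩ hx.2⟩
    · have := intermediate_value_Icc zero_le_one hc.continuousOn
      rwa [hm0, hm1] at this
  refine ⟨φ '' Ioo s t, ⟨hφ.isOpenMap _ isOpen_Ioo, ?_⟩, ?_, ?_⟩
  · have := nonempty_homeomorph_image hφ.isEmbedding (hm.mono Ioo_subset_Icc_self) hc.continuousOn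
    rwa [hIoo] at this
  · apply Subset.antisymm
    · rw [← closure_Ioo hst.ne]
      exact image_closure_subset_closure_image hφ.continuous
    · exact closure_minimal (image_mono Ioo_subset_Icc_self)
        (isCompact_Icc.image hφ.continuous).isClosed
  · have := nonempty_homeomorph_image hφ.isEmbedding hm hc.continuousOn
    rwa [hIcc] at this

/-- A connected set of diameter less than that of two open rays cannot contain the origins of
both, unless these coincide. -/
theorem ray_zero_eq_of_mem_of_diam_lt {X : Type*} [MetricSpace X] [CompactSpace X]
    {φ ψ : ℝ≥0 → X} (hφ : IsOpenEmbedding φ) (hψ : IsOpenEmbedding ψ) {C : Set X}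
    (hC : IsPreconnected C) (h : diam C < diam (range φ)) (h1 : φ 0 ∈ C) (h2 : ψ 0 ∈ C) :
    φ 0 = ψ 0 := by
  by_contra hne
  have hψr : ψ 0 ∉ range φ := by
    rintro ⟨s, hs⟩
    rw [eq_zero_of_ray_apply_eq_ray_zero hφ hψ hs] at hs
    exact hne hs
  refine h.not_ge (diam_mono ?_ (isCompact_univ.isBounded.subset (subset_univ C)))
  rintro _ ⟨t, rfl⟩
  rcases eq_or_ne t 0 with rfl | ht
  · exact h1
  · exact hC.apply_mem_of_ray hφ h1 ⟨0, pos_iff_ne_zero.2 ht, rfl⟩ h2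
      fun ⟨r, _, hr⟩ => hψr ⟨r, hr⟩

/-- In a compact locally connected space, a sequence of open rays of diameter bounded below
contains two rays with the same origin. -/
theorem exists_lt_ray_zero_eq {X : Type*} [MetricSpace X] [CompactSpace X]
    [LocallyConnectedSpace X] {φ : ℕ → ℝ≥0 → X} (hφ : ∀ n, IsOpenEmbedding (φ n)) {c : ℝ}
    (hc : 0 < c) (hdiam : ∀ n, c < diam (range (φ n))) : ∃ i j, i < j ∧ φ i 0 = φ j 0 := by
  obtain ⟨z, σ, hσ, hz⟩ := CompactSpace.tendsto_subseq fun n => φ n 0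
  obtain ⟨C, ⟨hCo, hzC, hC⟩, hCz⟩ := (LocallyConnectedSpace.open_connected_basis z).mem_iff.1
    (ball_mem_nhds z (half_pos hc))
  obtain ⟨N, hN⟩ := Filter.eventually_atTop.1 (hz.eventually (hCo.mem_nhds hzC))
  refine ⟨σ N, σ (N + 1), hσ (Nat.lt_succ_self N),
    ray_zero_eq_of_mem_of_diam_lt (hφ _) (hφ _) hC.isPreconnected (lt_of_le_of_lt ?_ (hdiam _))
      (hN N le_rfl) (hN (N + 1) (Nat.le_succ N))⟩
  calc diam C ≤ diam (ball z (c / 2)) := diam_mono hCz isBounded_ball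
    _ ≤ 2 * (c / 2) := diam_ball (half_pos hc).le
    _ = c := by ring

/-- A sensitive semigroup of continuous maps preserving open rays moves some open ray to a
different one with the same origin. -/
theorem exists_ray_comp_ne {X : Type*} [MetricSpace X] [CompactSpace X]
    [LocallyConnectedSpace X] {F : Set (X → X)} {c : ℝ} (hc : 0 < c)
    (hsemi : ∀ f ∈ F, ∀ g ∈ F, f ∘ g ∈ F)
    (hray : ∀ f ∈ F, ∀ φ : ℝ≥0 → X, IsOpenEmbedding φ → IsOpenEmbedding (f ∘ φ))
    (hsens : ∀ U : Set X, IsOpen U → U.Nonempty → ∃ f ∈ F, c < diam (f '' U))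
    {φ₀ : ℝ≥0 → X} (hφ₀ : IsOpenEmbedding φ₀) :
    ∃ φ : ℝ≥0 → X, ∃ g ∈ F, IsOpenEmbedding φ ∧ g (φ 0) = φ 0 ∧ g ∘ φ ≠ φ := by
  have hsmall : ∀ φ : ℝ≥0 → X, IsOpenEmbedding φ → ∃ ε > 0, diam (φ '' Iio ε) ≤ c := by
    intro φ hφ
    obtain ⟨ε, hε, hsub⟩ := exists_Ico_subset_of_mem_nhds
      (hφ.continuous.continuousAt (ball_mem_nhds (φ 0) (half_pos hc))) ⟨1, zero_lt_one⟩
    refine ⟨ε, hε, ?_⟩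
    calc diam (φ '' Iio ε) ≤ diam (ball (φ 0) (c / 2)) := by
          refine diam_mono ?_ isBounded_ball
          rintro _ ⟨r, hr, rfl⟩
          exact hsub ⟨zero_le, hr⟩
      _ ≤ 2 * (c / 2) := diam_ball (half_pos hc).le
      _ = c := by ring
  let P : Type _ := {p : (ℝ≥0 → X) × ℝ≥0 //
    IsOpenEmbedding p.1 ∧ 0 < p.2 ∧ diam (p.1 '' Iio p.2) ≤ c}
  have hstep : ∀ p : P, ∃ p' : P, p'.1.2 ≤ p.1.2 ∧ c < diam (p'.1.1 '' Iio p.1.2) ∧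
      ∃ f ∈ F, p'.1.1 = f ∘ p.1.1 := by
    rintro ⟨⟨φ, ε⟩, hφ, hε, hd⟩
    obtain ⟨f, hf, hfd⟩ := hsens _ (hφ.isOpenMap _ isOpen_Iio) ⟨φ 0, 0, hε, rfl⟩
    have hfφ := hray f hf φ hφ
    obtain ⟨δ, hδ, hδd⟩ := hsmall _ hfφ
    refine ⟨⟨⟨f ∘ φ, min δ ε⟩, hfφ, lt_min hδ hε, ?_⟩, min_le_right _ _, ?_, f, hf, rfl⟩
    · exact (diam_mono (image_mono (Iio_subset_Iio (min_le_left _ _)))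
        (isCompact_univ.isBounded.subset (subset_univ _))).trans hδd
    · rwa [← image_comp] at hfd
  choose next hle hbig hF using hstep
  obtain ⟨ε₀, hε₀, hd₀⟩ := hsmall φ₀ hφ₀
  let p : ℕ → P := fun n => next^[n] ⟨⟨φ₀, ε₀⟩, hφ₀, hε₀, hd₀⟩
  have hp : ∀ n, p (n + 1) = next (p n) := fun n => Function.iterate_succ_apply' _ _ _
  have hanti : Antitone fun n => (p n).1.2 := antitone_nat_of_succ_le fun n => by
    rw [hp]
    exact hle _
  have hcomp : ∀ i k, ∃ g ∈ F, (p (i + k + 1)).1.1 = g ∘ (p i).1.1 := by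
    intro i k
    induction k with
    | zero =>
      rw [add_zero, hp]
      exact hF _
    | succ k ih =>
      obtain ⟨g, hg, hgp⟩ := ih
      obtain ⟨f, hf, hfp⟩ := hF (p (i + (k + 1)))
      refine ⟨f ∘ g, hsemi f hf g hg, ?_⟩
      rw [hp, hfp, ← add_assoc, hgp, Function.comp_assoc]
  have hdiam : ∀ n, c < diam ((p (n + 1)).1.1 '' Iio (p n).1.2) := fun n => by
    rw [hp]
    exact hbig _
  have hmono : ∀ S T : Set X, S ⊆ T → diam S ≤ diam T := fun S T h =>
    diam_mono h (isCompact_univ.isBounded.subset (subset_univ _))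
  obtain ⟨i, j, hij, h0⟩ := exists_lt_ray_zero_eq (φ := fun n => (p (n + 1)).1.1)
    (fun n => (p (n + 1)).2.1) hc
    (fun n => (hdiam n).trans_le (hmono _ _ (image_subset_range _ _)))
  obtain ⟨k, rfl⟩ := Nat.exists_eq_add_of_lt hij
  obtain ⟨g, hg, hgp⟩ := hcomp (i + 1) k
  have hidx : i + 1 + k + 1 = i + k + 1 + 1 := by ring
  rw [hidx] at hgp
  refine ⟨(p (i + 1)).1.1, g, hg, (p (i + 1)).2.1, ?_, ?_⟩
  · have := congrFun hgp 0
    exact this.symm.trans h0.symm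
  · intro heq
    rw [heq] at hgp
    have h1 := hdiam (i + k + 1)
    rw [hgp] at h1
    refine h1.not_ge ((hmono _ _ (image_mono (Iio_subset_Iio ?_))).trans (p (i + 1)).2.2.2)
    exact hanti (by omega)

/-- Claim D': If `X` (Peano continuum with a free arc, neither arc
nor circle) has at least one maximal free open interval of Type I and `F` is a
sensitive commutative open-map semigroup with constant `c`, then there are a free
arc `A₁` and `f₁ ∈ F` with `A₁` a jumping arc of `f₁`, and `A₁` and `f₁(A₁)`
contained in the same maximal free open interval of Type I. -/
theorem stmt_18 (X : Type*) [MetricSpace X] [CompactSpace X] [ConnectedSpace X]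
    [LocallyConnectedSpace X]
    (hfree : ∃ A : Set X, IsFreeArc A)
    (harc : ¬ SpaceIsArc X) (hcirc : ¬ SpaceIsCircle X)
    (hexI : ∃ J : Set X, IsTypeI J)
    (F : Set (X → X))
    (hcont : ∀ f ∈ F, Continuous f)
    (hopen : ∀ f ∈ F, IsOpenMap f)
    (hsemi : ∀ f ∈ F, ∀ g ∈ F, f ∘ g ∈ F)
    (hcomm : ∀ f ∈ F, ∀ g ∈ F, f ∘ g = g ∘ f)
    (c : ℝ) (hc : 0 < c)
    (hsens : ∀ U : Set X, IsOpen U → U.Nonempty → ∃ f ∈ F, c < Metric.diam (f '' U)) :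
    ∃ A₁ : Set X, ∃ f₁ ∈ F, IsFreeArc A₁ ∧ A₁ ∩ (f₁ '' A₁) = ∅ ∧
      ∃ J : Set X, IsTypeI J ∧ A₁ ⊆ J ∧ f₁ '' A₁ ⊆ J := by
  obtain ⟨J₀, ⟨⟨⟨hJo, -⟩, -⟩, a, b, hab, ha, hb, hcl, hends, hend⟩⟩ := hexI
  have : Nontrivial X := ⟨a, b, hab⟩
  obtain ⟨φ₀, hφ₀⟩ : ∃ φ : ℝ≥0 → X, IsOpenEmbedding φ := by
    rcases hend with h | h
    · exact exists_ray_of_isEndpointOf hJo hab ha hb hcl hends h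
    · exact exists_ray_of_isEndpointOf hJo hab.symm hb ha (by rw [hcl, pair_comm]) hends.symm h
  have hray : ∀ f ∈ F, ∀ φ : ℝ≥0 → X, IsOpenEmbedding φ → IsOpenEmbedding (f ∘ φ) :=
    fun f hf φ hφ => isOpenEmbedding_of_not_spaceIsArc harc
      ((hcont f hf).comp hφ.continuous) ((hopen f hf).comp hφ.isOpenMap)
  obtain ⟨φ, g, hg, hφ, hfix, hne⟩ := exists_ray_comp_ne hc hsemi hray hsens hφ₀
  obtain ⟨J, hJ, hJray⟩ := exists_isTypeI_of_ray hφ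
  have hgφ := hray g hg φ hφ
  obtain ⟨t, ht⟩ := Function.ne_iff.1 hne
  have ht0 : 0 < t := by
    rw [pos_iff_ne_zero]
    rintro rfl
    exact ht hfix
  obtain ⟨U, V, hU, hV, htU, htV, hUV⟩ := t2_separation ht
  have hnhds : (g ∘ φ) ⁻¹' U ∩ φ ⁻¹' V ∩ Ioi 0 ∈ 𝓝 t :=
    (((hU.preimage hgφ.continuous).inter (hV.preimage hφ.continuous)).inter isOpen_Ioi).mem_nhds
      ⟨⟨htU, htV⟩, ht0⟩
  obtain ⟨u, hu, hsub⟩ := exists_Ico_subset_of_mem_nhds hnhds ⟨t + 1, lt_add_one t⟩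
  obtain ⟨r, htr, hru⟩ := exists_between hu
  have hIcc : Icc t r ⊆ (g ∘ φ) ⁻¹' U ∩ φ ⁻¹' V ∩ Ioi 0 := fun x hx =>
    hsub ⟨hx.1, hx.2.trans_lt hru⟩
  have hIoi : Icc t r ⊆ Ioi 0 := fun x hx => (hIcc hx).2
  refine ⟨φ '' Icc t r, g, hg, isFreeArc_image_Icc hφ htr, ?_, J, hJ, ?_, ?_⟩
  · rw [← image_comp, ← disjoint_iff_inter_eq_empty]
    exact hUV.symm.mono (image_subset_iff.2 fun x hx => (hIcc hx).1.2)
      (image_subset_iff.2 fun x hx => (hIcc hx).1.1)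
  · exact (image_mono hIoi).trans (hJray φ hφ rfl)
  · rw [← image_comp]
    exact (image_mono hIoi).trans (hJray (g ∘ φ) hgφ hfix)
end
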